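/- arXiv:2402.10661 — 6 statements merged into one kernel-verified Lean document; each statement's English description precedes it below -/
import Mathlib

section
/- Assume c ≥ 1/2 (equivalently, there exists r > 0 with 1 ≤ r² ≤ 2c). Then for every L ≥ 1, |∫_ℝ K_{L,c}(x,x) dx − 2·∫_0^∞ Ai(2x+2c) dx + 2·L·Ai′(2c)| ≤ e^{−4L³/3}. -/
open MeasureTheory

/-- The Airy function, defined by an absolutely convergent contour integral
over the vertical line `Re w = 1`. -/
noncomputable def Ai (x : ℝ) : ℝ :=
  (1 / (2 * Real.pi)) *
    ∫ t : ℝ, (Complex.exp ((1 + (t : ℂ) * Complex.I) ^ 3 / 3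
      - (1 + (t : ℂ) * Complex.I) * (x : ℂ))).re

/-- The derivative of the Airy function. -/
noncomputable def Ai' (x : ℝ) : ℝ :=
  -(1 / (2 * Real.pi)) *
    ∫ t : ℝ, ((1 + (t : ℂ) * Complex.I) * Complex.exp ((1 + (t : ℂ) * Complex.I) ^ 3 / 3
      - (1 + (t : ℂ) * Complex.I) * (x : ℂ))).re

/-- Heat kernel `G_L(u,v)`. -/
noncomputable def G (L u v : ℝ) : ℝ :=
  (4 * Real.pi * L) ^ (-(1 : ℝ) / 2) * Real.exp (-(u - v) ^ 2 / (4 * L))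

/-- The kernel `E_{L,c}(u,v)` of `e^{-LΔ}B_{0,c}`. -/
noncomputable def E (L c u v : ℝ) : ℝ :=
  Real.exp (-2 * L ^ 3 / 3 - L * (u + v + 2 * c)) * Ai (L ^ 2 + u + v + 2 * c)

/-- The kernel `K_{L,c}(x,y)`. -/
noncomputable def K (L c x y : ℝ) : ℝ :=
  (if 0 < x then Ai (x + y + 2 * c) else 0)
  + (if x ≤ 0 then ∫ z in Set.Ioi (0 : ℝ), G L x z * E L c z y else 0)
  + (if x ≤ 0 then ∫ z in Set.Iic (0 : ℝ), G L (-x) z * E L c z y else 0)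

open Filter Topology Set Complex

/-- The integral of an entire function along a vertical line does not depend on the line, as long
as the function decays like a Gaussian in the strip swept out. -/
lemma integral_vertical_line_eq {f : ℂ → ℂ} (hf : Differentiable ℂ f) {σ C : ℝ} (hσ : 1 ≤ σ)
    (hC : ∀ x ∈ Icc 1 σ, ∀ t : ℝ, ‖f (x + t * I)‖ ≤ C * Real.exp (-(1 / 2) * t ^ 2)) :
    Integrable (fun t : ℝ => f (1 + t * I)) ∧
      ∫ t : ℝ, f (1 + t * I) = ∫ t : ℝ, f (σ + t * I) := by
  have hint : ∀ x ∈ Icc 1 σ, Integrable (fun t : ℝ => f (x + t * I)) := fun x hx =>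
    ((integrable_exp_neg_mul_sq (by norm_num : (0 : ℝ) < 1 / 2)).const_mul C).mono'
      (hf.continuous.comp (by fun_prop)).aestronglyMeasurable (ae_of_all _ (hC x hx))
  have h1 := hint 1 ⟨le_rfl, hσ⟩
  have h2 := hint σ ⟨hσ, le_rfl⟩
  refine ⟨by simpa using h1, ?_⟩
  have hgauss : Tendsto (fun T : ℝ => C * Real.exp (-(1 / 2) * T ^ 2) * |σ - 1|) atTop (𝓝 0) := by
    have : Tendsto (fun T : ℝ => Real.exp (-(1 / 2) * T ^ 2)) atTop (𝓝 0) :=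
      Real.tendsto_exp_atBot.comp
        ((tendsto_pow_atTop two_ne_zero).const_mul_atTop_of_neg (by norm_num))
    simpa using (this.const_mul C).mul_const |σ - 1|
  have hhor : ∀ s : ℝ, s ^ 2 = 1 → Tendsto
      (fun T : ℝ => ∫ x : ℝ in (1 : ℝ)..σ, f (x + ((s * T : ℝ) : ℂ) * I)) atTop (𝓝 0) := by
    intro s hs
    refine squeeze_zero_norm (fun T => ?_) hgauss
    refine intervalIntegral.norm_integral_le_of_norm_le_const fun x hx => ?_
    rw [uIoc_of_le hσ] at hx
    refine (hC x ⟨hx.1.le, hx.2⟩ (s * T)).trans_eq ?_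
    rw [mul_pow, hs, one_mul]
  have hrect : ∀ T : ℝ, (∫ t : ℝ in (-T)..T, f (σ + t * I)) - (∫ t : ℝ in (-T)..T, f (1 + t * I)) =
      -I * ((∫ x : ℝ in (1 : ℝ)..σ, f (x + ((1 * T : ℝ) : ℂ) * I)) -
        ∫ x : ℝ in (1 : ℝ)..σ, f (x + ((-1 * T : ℝ) : ℂ) * I)) := by
    intro T
    have := integral_boundary_rect_eq_zero_of_differentiableOn f (1 + ((-T : ℝ) : ℂ) * I)
      (σ + (T : ℂ) * I) hf.differentiableOn
    simp only [add_re, one_re, mul_re, ofReal_re, I_re, mul_zero, ofReal_im, I_im, mul_one,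
      sub_self, add_zero, add_im, one_im, mul_im, zero_add, smul_eq_mul, ofReal_one] at this
    simp only [one_mul, neg_mul]
    linear_combination (-I) * this + ((∫ t : ℝ in (-T)..T, f (σ + t * I)) -
      (∫ t : ℝ in (-T)..T, f (1 + t * I))) * I_sq
  have hlim := (intervalIntegral_tendsto_integral h2 tendsto_neg_atTop_atBot tendsto_id).sub
    (intervalIntegral_tendsto_integral h1 tendsto_neg_atTop_atBot tendsto_id)
  have hlim' := ((hhor 1 (by norm_num)).sub (hhor (-1) (by norm_num))).const_mul (-I)
  simp only [id, ofReal_one, hrect] at hlim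
  have := tendsto_nhds_unique hlim hlim'
  simp only [sub_zero, mul_zero] at this
  exact (sub_eq_zero.mp this).symm

lemma norm_airy_integrand (y x t : ℝ) :
    ‖cexp ((x + t * I) ^ 3 / 3 - (x + t * I) * y)‖ =
      Real.exp (x ^ 3 / 3 - x * y) * Real.exp (-x * t ^ 2) := by
  rw [norm_exp, ← Real.exp_add]
  congr 1
  have : ((x : ℂ) + t * I) ^ 3 / 3 - (x + t * I) * y =
      ((x ^ 3 / 3 - x * y + -x * t ^ 2 : ℝ) : ℂ) + ((x ^ 2 * t - t ^ 3 / 3 - t * y : ℝ) : ℂ) * I := by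
    push_cast
    linear_combination ((x : ℂ) * t ^ 2 + t ^ 3 * I / 3) * I_sq
  rw [this, add_re, ofReal_re, re_ofReal_mul, I_re]
  ring

lemma norm_airy_integrand_le {σ x : ℝ} (hx : x ∈ Icc 1 σ) (y t : ℝ) :
    ‖cexp ((x + t * I) ^ 3 / 3 - (x + t * I) * y)‖ ≤
      Real.exp (σ ^ 3 / 3 + σ * |y|) * Real.exp (-t ^ 2) := by
  rw [norm_airy_integrand]
  obtain ⟨h1, h2⟩ := hx
  have h3 : x ^ 3 ≤ σ ^ 3 := pow_le_pow_left₀ (by linarith) h2 3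
  have h4 : -(x * y) ≤ σ * |y| := by
    calc -(x * y) = x * -y := by ring
      _ ≤ x * |y| := by gcongr; exact neg_le_abs y
      _ ≤ σ * |y| := by gcongr
  gcongr
  · linarith
  · nlinarith [sq_nonneg t]

lemma airy_line_integral {σ : ℝ} (hσ : 1 ≤ σ) (y : ℝ) :
    Ai y = 1 / (2 * Real.pi) *
      (∫ t : ℝ, cexp ((σ + t * I) ^ 3 / 3 - (σ + t * I) * y)).re := by
  obtain ⟨h2, h3⟩ := integral_vertical_line_eq
    (f := fun w => cexp (w ^ 3 / 3 - w * y)) (by fun_prop) hσ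
    (C := Real.exp (σ ^ 3 / 3 + σ * |y|)) fun x hx t => by
      refine (norm_airy_integrand_le hx y t).trans ?_
      gcongr
      nlinarith [sq_nonneg t]
  rw [Ai, ← h3]
  congr 1
  exact integral_re h2

lemma airy_deriv_line_integral {σ : ℝ} (hσ : 1 ≤ σ) (y : ℝ) :
    Ai' y = -(1 / (2 * Real.pi)) *
        (∫ t : ℝ, (σ + t * I) * cexp ((σ + t * I) ^ 3 / 3 - (σ + t * I) * y)).re := by
  obtain ⟨h2, h3⟩ := integral_vertical_line_eq
    (f := fun w => w * cexp (w ^ 3 / 3 - w * y)) (by fun_prop) hσ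
    (C := σ * Real.exp (1 / 2) * Real.exp (σ ^ 3 / 3 + σ * |y|)) fun x hx t => by
      have hw : ‖(x : ℂ) + t * I‖ ≤ σ * Real.exp (1 / 2 + t ^ 2 / 2) := by
        calc ‖(x : ℂ) + t * I‖ ≤ |x| + |t| := by
              refine (norm_add_le _ _).trans ?_
              simp
          _ ≤ σ * (1 + |t|) := by
              rw [abs_of_nonneg (by linarith [hx.1])]
              nlinarith [hx.2, abs_nonneg t]
          _ ≤ σ * Real.exp (1 / 2 + t ^ 2 / 2) := by
              gcongr
              have := Real.add_one_le_exp (1 / 2 + t ^ 2 / 2)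
              nlinarith [sq_abs t, sq_nonneg (|t| - 1)]
      rw [norm_mul]
      refine (mul_le_mul hw (norm_airy_integrand_le hx y t) (norm_nonneg _)
        (by positivity)).trans_eq ?_
      have : Real.exp (1 / 2 + t ^ 2 / 2) * Real.exp (-t ^ 2) =
          Real.exp (1 / 2) * Real.exp (-(1 / 2) * t ^ 2) := by
        rw [← Real.exp_add, ← Real.exp_add]; congr 1; ring
      linear_combination σ * Real.exp (σ ^ 3 / 3 + σ * |y|) * this
  rw [Ai', ← h3]
  congr 1
  exact integral_re h2

lemma abs_Ai_le {σ : ℝ} (hσ : 1 ≤ σ) (y : ℝ) : |Ai y| ≤ Real.exp (σ ^ 3 / 3 - σ * y) := by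
  rw [airy_line_integral hσ y, abs_mul, abs_of_pos (by positivity)]
  have h1 : |(∫ t : ℝ, cexp ((σ + t * I) ^ 3 / 3 - (σ + t * I) * y)).re| ≤
      Real.exp (σ ^ 3 / 3 - σ * y) * √(Real.pi / σ) := by
    refine (abs_re_le_norm _).trans ((norm_integral_le_integral_norm _).trans_eq ?_)
    simp_rw [norm_airy_integrand, integral_const_mul, integral_gaussian]
  have h2 : √(Real.pi / σ) ≤ 2 * Real.pi := by
    rw [Real.sqrt_le_left (by positivity)]
    have h3 := Real.pi_gt_three
    have : Real.pi / σ ≤ Real.pi := div_le_self (by positivity) hσ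
    nlinarith
  calc _ ≤ 1 / (2 * Real.pi) * (Real.exp (σ ^ 3 / 3 - σ * y) * (2 * Real.pi)) := by
        gcongr
        exact h1.trans (by gcongr)
    _ = _ := by field_simp

lemma measurable_Ai : Measurable Ai := by
  unfold Ai
  refine Measurable.const_mul (StronglyMeasurable.measurable ?_) _
  refine StronglyMeasurable.integral_prod_right (f := fun x t : ℝ =>
    (cexp ((1 + (t : ℂ) * I) ^ 3 / 3 - (1 + (t : ℂ) * I) * (x : ℂ))).re) ?_
  exact Continuous.stronglyMeasurable (by fun_prop)

lemma continuous_G (L : ℝ) : Continuous (fun p : ℝ × ℝ => G L p.1 p.2) := by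
  unfold G
  fun_prop

lemma continuous_G_right (L u : ℝ) : Continuous (fun v => G L u v) := by
  unfold G
  fun_prop

lemma measurable_E (L c : ℝ) : Measurable (fun p : ℝ × ℝ => E L c p.1 p.2) := by
  have := measurable_Ai
  unfold E
  fun_prop

lemma E_eq_zero_add (L c u v : ℝ) : E L c u v = E L c 0 (u + v) := by
  unfold E
  simp only [add_assoc, zero_add]

lemma E_add_right (L c u v y : ℝ) : E L c u (v + y) = E L (c + y / 2) u v := by
  have h : u + (v + y) + 2 * c = u + v + 2 * (c + y / 2) := by ring
  have h' : L ^ 2 + u + (v + y) + 2 * c = L ^ 2 + u + v + 2 * (c + y / 2) := by ring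
  simp only [E, h, h']

lemma G_eq_sub (L u v : ℝ) : G L u v = G L 0 (v - u) := by
  simp only [G, zero_sub, neg_sub]

lemma G_comm (L u v : ℝ) : G L u v = G L v u := by
  simp only [G, ← neg_sub v u, neg_sq]

lemma G_nonneg {L : ℝ} (hL : 1 ≤ L) (u v : ℝ) : 0 ≤ G L u v := by
  unfold G
  positivity

lemma G_le_one {L : ℝ} (hL : 1 ≤ L) (u v : ℝ) : G L u v ≤ 1 := by
  unfold G
  refine mul_le_one₀ ?_ (Real.exp_pos _).le ?_
  · refine Real.rpow_le_one_of_one_le_of_nonpos ?_ (by norm_num)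
    nlinarith [Real.pi_gt_three]
  · rw [Real.exp_le_one_iff]
    exact div_nonpos_of_nonpos_of_nonneg (by nlinarith [sq_nonneg (u - v)]) (by linarith)

lemma abs_E_le {L : ℝ} (hL : 1 ≤ L) (c u v : ℝ) :
    |E L c u v| ≤ Real.exp (-4 * L ^ 3 / 3 - 4 * L * c) * Real.exp (-2 * L * (u + v)) := by
  rw [E, abs_mul, abs_of_pos (Real.exp_pos _)]
  refine (mul_le_mul_of_nonneg_left (abs_Ai_le hL _) (Real.exp_pos _).le).trans_eq ?_
  rw [← Real.exp_add, ← Real.exp_add]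
  congr 1
  ring

lemma E_line_integral {L : ℝ} (hL : 1 ≤ L) (c s : ℝ) :
    E L c 0 s = 1 / (2 * Real.pi) * (∫ t : ℝ, cexp ((2 * L + t * I) ^ 3 / 3
      - L * (2 * L + t * I) ^ 2 - 2 * c * (2 * L + t * I)) * cexp (-(2 * L + t * I) * s)).re := by
  rw [E, airy_line_integral hL, mul_left_comm, ← re_ofReal_mul, ← integral_const_mul]
  congr 3
  ext t
  rw [ofReal_exp, ← Complex.exp_add, ← Complex.exp_add]
  congr 1
  push_cast
  ring

lemma norm_E_integrand (L c t s : ℝ) :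
    ‖cexp ((2 * L + t * I) ^ 3 / 3 - L * (2 * L + t * I) ^ 2 - 2 * c * (2 * L + t * I)) *
      cexp (-(2 * L + t * I) * s)‖ =
      Real.exp (-4 * L ^ 3 / 3 - 4 * L * c) * Real.exp (-L * t ^ 2) *
        Real.exp (-2 * L * s) := by
  rw [← Complex.exp_add, norm_exp, ← Real.exp_add, ← Real.exp_add]
  congr 1
  have : (2 * L + t * I : ℂ) ^ 3 / 3 - L * (2 * L + t * I) ^ 2 - 2 * c * (2 * L + t * I) +
      -(2 * L + t * I) * s =
      ((-4 * L ^ 3 / 3 - 4 * L * c + -L * t ^ 2 + -2 * L * s : ℝ) : ℂ) +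
        ((-t ^ 3 / 3 - 2 * c * t - t * s : ℝ) : ℂ) * I := by
    push_cast
    linear_combination ((L : ℂ) * t ^ 2 + t ^ 3 * I / 3) * I_sq
  rw [this, add_re, ofReal_re, re_ofReal_mul, I_re]
  ring

/-- Pairing `E` with a weight `p` amounts to inserting the bilateral Laplace transform `q` of `p`
into the contour integral. -/
lemma integral_mul_E {L : ℝ} (hL : 1 ≤ L) (c : ℝ) {p : ℝ → ℝ} (hp : Continuous p)
    (hpi : Integrable (fun s => p s * Real.exp (-2 * L * s))) {q : ℂ → ℂ}
    (hq : ∀ t : ℝ, ∫ s : ℝ, (p s : ℂ) * cexp (-(2 * L + t * I) * s) = q (2 * L + t * I)) :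
    ∫ s, p s * E L c 0 s = 1 / (2 * Real.pi) * (∫ t : ℝ, cexp ((2 * L + t * I) ^ 3 / 3
      - L * (2 * L + t * I) ^ 2 - 2 * c * (2 * L + t * I)) * q (2 * L + t * I)).re := by
  have hint : Integrable (Function.uncurry fun s t : ℝ => (p s : ℂ) *
      (cexp ((2 * L + t * I) ^ 3 / 3 - L * (2 * L + t * I) ^ 2 - 2 * c * (2 * L + t * I)) *
        cexp (-(2 * L + t * I) * s))) (volume.prod volume) := by
    have hg := (integrable_exp_neg_mul_sq (by linarith : (0 : ℝ) < L)).const_mul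
      (Real.exp (-4 * L ^ 3 / 3 - 4 * L * c))
    refine (hpi.norm.mul_prod hg).mono' (Continuous.aestronglyMeasurable ?_)
      (ae_of_all _ fun z => ?_)
    · unfold Function.uncurry
      fun_prop
    · simp only [Function.uncurry]
      rw [norm_mul, norm_E_integrand, norm_real, norm_mul, Real.norm_of_nonneg (Real.exp_pos _).le]
      exact le_of_eq (by ring)
  have hswap := integral_integral_swap hint
  have houter := hint.integral_prod_left
  simp only [Function.uncurry] at houter
  calc ∫ s, p s * E L c 0 s
      = ∫ s, 1 / (2 * Real.pi) * (∫ t : ℝ, (p s : ℂ) * (cexp ((2 * L + t * I) ^ 3 / 3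
          - L * (2 * L + t * I) ^ 2 - 2 * c * (2 * L + t * I)) *
            cexp (-(2 * L + t * I) * s))).re := by
        congr 1
        ext s
        rw [E_line_integral hL, integral_const_mul, re_ofReal_mul]
        ring
    _ = 1 / (2 * Real.pi) * (∫ s, ∫ t : ℝ, (p s : ℂ) * (cexp ((2 * L + t * I) ^ 3 / 3
          - L * (2 * L + t * I) ^ 2 - 2 * c * (2 * L + t * I)) *
            cexp (-(2 * L + t * I) * s))).re := by
        rw [integral_const_mul]
        congr 1
        exact integral_re houter
    _ = _ := by
        rw [hswap]
        congr 3
        ext t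
        rw [← hq, ← integral_const_mul]
        congr 1
        ext s
        ring

lemma G_mul_cexp {L : ℝ} (w : ℂ) (s : ℝ) :
    (G L 0 s : ℂ) * cexp (w * s) = (((4 * Real.pi * L) ^ (-(1 : ℝ) / 2) : ℝ) : ℂ) *
      cexp (-((1 / (4 * L) : ℝ) : ℂ) * s ^ 2 + w * s + 0) := by
  rw [G, ofReal_mul, mul_assoc, ofReal_exp, ← Complex.exp_add]
  congr 2
  push_cast
  ring

lemma integrable_G_mul_cexp {L : ℝ} (hL : 1 ≤ L) (w : ℂ) :
    Integrable (fun s : ℝ => (G L 0 s : ℂ) * cexp (w * s)) := by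
  simp_rw [G_mul_cexp]
  refine (integrable_cexp_quadratic ?_ w 0).const_mul _
  rw [ofReal_re]
  positivity

lemma integral_G_mul_cexp {L : ℝ} (hL : 1 ≤ L) (w : ℂ) :
    ∫ s : ℝ, (G L 0 s : ℂ) * cexp (w * s) = cexp (L * w ^ 2) := by
  have hL0 : 0 < L := by linarith
  have hLc : (L : ℂ) ≠ 0 := by exact_mod_cast hL0.ne'
  simp_rw [G_mul_cexp]
  rw [integral_const_mul, integral_cexp_quadratic (by rw [neg_re, ofReal_re]; simpa using hL0),
    ← mul_assoc]
  have h1 : (Real.pi / - -((1 / (4 * L) : ℝ) : ℂ)) ^ (1 / 2 : ℂ) =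
      (((4 * Real.pi * L) ^ ((1 : ℝ) / 2) : ℝ) : ℂ) := by
    rw [ofReal_cpow (by positivity)]
    push_cast
    congr 1
    field_simp
  rw [h1, ← ofReal_mul, ← Real.rpow_add (by positivity)]
  norm_num
  congr 1
  field_simp

lemma integrable_G_mul_exp {L : ℝ} (hL : 1 ≤ L) (a : ℝ) :
    Integrable (fun s : ℝ => G L 0 s * Real.exp (a * s)) := by
  have := (integrable_G_mul_cexp hL a).re
  refine this.congr (ae_of_all _ fun s => ?_)
  simp only [← ofReal_mul, ← ofReal_exp, RCLike.re_to_complex, ofReal_re]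

lemma integrable_id_mul_G_mul_cexp {L : ℝ} (hL : 1 ≤ L) (w : ℂ) :
    Integrable (fun s : ℝ => (s : ℂ) * ((G L 0 s : ℂ) * cexp (w * s))) := by
  have hc := continuous_G_right L 0
  refine ((integrable_G_mul_exp hL (w.re + 1)).add
    (integrable_G_mul_exp hL (w.re - 1))).mono' (by fun_prop) (ae_of_all _ fun s => ?_)
  have h : |s| ≤ Real.exp s + Real.exp (-s) := by
    rcases abs_cases s with ⟨h, -⟩ | ⟨h, -⟩ <;> rw [h]
    · linarith [Real.add_one_le_exp s, Real.exp_pos (-s)]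
    · linarith [Real.add_one_le_exp (-s), Real.exp_pos s]
  rw [norm_mul, norm_mul, norm_real, norm_real, norm_exp, Real.norm_eq_abs,
    Real.norm_of_nonneg (G_nonneg hL _ _), re_mul_ofReal]
  refine (mul_le_mul_of_nonneg_right h
    (mul_nonneg (G_nonneg hL _ _) (Real.exp_pos _).le)).trans_eq ?_
  simp only [Pi.add_apply]
  rw [show (w.re + 1) * s = w.re * s + s by ring, show (w.re - 1) * s = w.re * s + -s by ring,
    Real.exp_add, Real.exp_add]
  ring

lemma integrable_id_mul_G_mul_exp {L : ℝ} (hL : 1 ≤ L) (a : ℝ) :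
    Integrable (fun s : ℝ => s * (G L 0 s * Real.exp (a * s))) := by
  have := (integrable_id_mul_G_mul_cexp hL a).re
  refine this.congr (ae_of_all _ fun s => ?_)
  simp only [← ofReal_mul, ← ofReal_exp, RCLike.re_to_complex, ofReal_re]

lemma integral_id_mul_G_mul_cexp {L : ℝ} (hL : 1 ≤ L) (w : ℂ) :
    ∫ s : ℝ, (s : ℂ) * ((G L 0 s : ℂ) * cexp (w * s)) = 2 * L * w * cexp (L * w ^ 2) := by
  have hL0 : 0 < L := by linarith
  have hLc : (L : ℂ) ≠ 0 := by exact_mod_cast hL0.ne'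
  have hderiv : ∀ s : ℝ, HasDerivAt (fun s : ℝ => (G L 0 s : ℂ) * cexp (w * s))
      (w * ((G L 0 s : ℂ) * cexp (w * s)) -
        1 / (2 * L) * ((s : ℂ) * ((G L 0 s : ℂ) * cexp (w * s)))) s := by
    intro s
    simp_rw [G_mul_cexp]
    have h := (((((hasDerivAt_id (s : ℂ)).pow 2).const_mul (-((1 / (4 * L) : ℝ) : ℂ))).add
      ((hasDerivAt_id (s : ℂ)).const_mul w)).add_const 0).cexp.const_mul
        (((4 * Real.pi * L) ^ (-(1 : ℝ) / 2) : ℝ) : ℂ)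
    refine h.comp_ofReal.congr_deriv ?_
    simp only [Pi.add_apply, Pi.pow_apply, id, ofReal_div, ofReal_one, ofReal_mul, ofReal_ofNat]
    push_cast
    field_simp
    ring
  have h1 := (integrable_G_mul_cexp hL w).const_mul w
  have h2 := (integrable_id_mul_G_mul_cexp hL w).const_mul (1 / (2 * L : ℂ))
  have := integral_eq_zero_of_hasDerivAt_of_integrable hderiv (h1.sub h2)
    (integrable_G_mul_cexp hL w)
  rw [integral_sub h1 h2, integral_const_mul, integral_const_mul, integral_G_mul_cexp hL] at this
  have hL2 : (2 * L : ℂ) * (1 / (2 * L)) = 1 := by field_simp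
  linear_combination (-2 * L : ℂ) * this -
    (∫ s : ℝ, (s : ℂ) * ((G L 0 s : ℂ) * cexp (w * s))) * hL2

lemma integral_G_mul_E {L : ℝ} (hL : 1 ≤ L) (c : ℝ) : ∫ s, G L 0 s * E L c 0 s = Ai (2 * c) := by
  rw [integral_mul_E hL c (continuous_G_right L 0) (integrable_G_mul_exp hL _)
    (q := fun w => cexp (L * w ^ 2)) fun t => ?_,
    airy_line_integral (by linarith : 1 ≤ 2 * L)]
  · congr 3
    ext t
    rw [← Complex.exp_add]
    congr 1
    push_cast
    ring
  · rw [integral_G_mul_cexp hL, neg_sq]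

lemma integral_neg_id_mul_G_mul_E {L : ℝ} (hL : 1 ≤ L) (c : ℝ) :
    ∫ s, -s * (G L 0 s * E L c 0 s) = -(2 * L * Ai' (2 * c)) := by
  have hG := continuous_G_right L 0
  simp_rw [← mul_assoc]
  rw [integral_mul_E hL c (by fun_prop) ?_
    (q := fun w => 2 * L * w * cexp (L * w ^ 2)) fun t => ?_,
    airy_deriv_line_integral (by linarith : 1 ≤ 2 * L)]
  · rw [show -(2 * L * (-(1 / (2 * Real.pi)) * (∫ t : ℝ, (((2 * L : ℝ) : ℂ) + t * I) *
        cexp ((((2 * L : ℝ) : ℂ) + t * I) ^ 3 / 3 -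
          (((2 * L : ℝ) : ℂ) + t * I) * ((2 * c : ℝ) : ℂ))).re)) =
      1 / (2 * Real.pi) * ((2 * L) * (∫ t : ℝ, (((2 * L : ℝ) : ℂ) + t * I) *
        cexp ((((2 * L : ℝ) : ℂ) + t * I) ^ 3 / 3 -
          (((2 * L : ℝ) : ℂ) + t * I) * ((2 * c : ℝ) : ℂ))).re) by ring,
      ← re_ofReal_mul (2 * L), ← integral_const_mul]
    congr 3
    ext t
    rw [mul_left_comm, ← Complex.exp_add]
    push_cast
    rw [mul_assoc (2 * (L : ℂ))]
    congr 3
    ring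
  · refine (integrable_id_mul_G_mul_exp hL (-2 * L)).neg.congr (ae_of_all _ fun s => ?_)
    simp only [Pi.neg_apply]
    ring
  · have := integral_id_mul_G_mul_cexp hL (-(2 * L + t * I))
    rw [neg_sq] at this
    rw [show ∀ a b : ℂ, 2 * a * b * cexp (a * b ^ 2) = -(2 * a * -b * cexp (a * b ^ 2)) by
      intros; ring, ← this, ← integral_neg]
    congr 1
    ext s
    push_cast
    ring

lemma integral_Iic_Iic_add {f : ℝ → ℝ} (hf : AEStronglyMeasurable f)
    (hfi : Integrable (fun s => s * f s)) :
    IntegrableOn (fun x => ∫ z in Iic (0 : ℝ), f (x + z)) (Iic 0) ∧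
      ∫ x in Iic (0 : ℝ), ∫ z in Iic (0 : ℝ), f (x + z) = ∫ s in Iic (0 : ℝ), -s * f s := by
  set A : Set (ℝ × ℝ) := {p | p.2 ≤ p.1 ∧ p.1 ≤ 0} with hA
  have hAm : MeasurableSet A :=
    (measurableSet_le measurable_snd measurable_fst).inter
      (measurableSet_le measurable_fst measurable_const)
  have hx : ∀ x s : ℝ, A.indicator (fun p => f p.2) (x, s) =
      (Iic 0).indicator (fun x => (Iic x).indicator f s) x := by
    intro x s
    by_cases h1 : s ≤ x <;> by_cases h2 : x ≤ 0 <;> simp [hA, indicator, h1, h2]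
  have hs : ∀ x s : ℝ, A.indicator (fun p => f p.2) (x, s) =
      (Icc s 0).indicator (fun _ => f s) x := by
    intro x s
    by_cases h1 : s ≤ x <;> by_cases h2 : x ≤ 0 <;> simp [hA, indicator, h1, h2]
  have hvol : ∀ s : ℝ, volume.real (Icc s 0) = max (-s) 0 := by
    intro s
    simp [Measure.real, Real.volume_Icc, ENNReal.toReal_ofReal']
  have hint : Integrable (A.indicator (fun p : ℝ × ℝ => f p.2)) (volume.prod volume) := by
    have hm : AEStronglyMeasurable (A.indicator (fun p : ℝ × ℝ => f p.2))
        (volume.prod volume) := hf.comp_snd.indicator hAm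
    refine (integrable_prod_iff' hm).2 ⟨ae_of_all _ fun s => ?_, ?_⟩
    · simp_rw [hs]
      exact (integrable_indicator_iff measurableSet_Icc).2 (by simp)
    · refine hfi.norm.mono' hm.norm.prod_swap.integral_prod_right' (ae_of_all _ fun s => ?_)
      simp_rw [hs, norm_indicator_eq_indicator_norm]
      rw [integral_indicator measurableSet_Icc, setIntegral_const, hvol, smul_eq_mul, norm_mul,
        norm_mul, norm_norm]
      gcongr
      rw [Real.norm_eq_abs, Real.norm_eq_abs, abs_of_nonneg (le_max_right _ _)]
      exact max_le (neg_le_abs s) (abs_nonneg s)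
  have hinner : ∀ x : ℝ, (Iic (0 : ℝ)).indicator (fun x => ∫ z in Iic (0 : ℝ), f (x + z)) x =
      ∫ s, A.indicator (fun p => f p.2) (x, s) := by
    intro x
    simp_rw [hx]
    by_cases h : x ∈ Iic (0 : ℝ)
    · simp only [indicator_of_mem h]
      rw [← integral_indicator measurableSet_Iic,
        ← integral_add_left_eq_self (fun s => (Iic x).indicator f s) x]
      congr 1
      ext z
      simp [indicator]
    · simp only [indicator_of_notMem h, integral_zero]
  have hL := hint.integral_prod_left
  simp_rw [← hinner] at hL
  refine ⟨(integrable_indicator_iff measurableSet_Iic).1 hL, ?_⟩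
  rw [← integral_indicator measurableSet_Iic]
  simp_rw [hinner]
  rw [integral_integral_swap (f := fun x s => A.indicator (fun p : ℝ × ℝ => f p.2) (x, s)) hint,
    ← integral_indicator measurableSet_Iic]
  congr 1
  ext s
  simp_rw [hs]
  rw [integral_indicator measurableSet_Icc, setIntegral_const, hvol, smul_eq_mul]
  by_cases h : s ≤ 0
  · simp [indicator, h]
  · simp [indicator, h, le_of_not_ge h]

lemma integrable_G_mul_E_prod {L : ℝ} (hL : 1 ≤ L) (c : ℝ) :
    Integrable (fun p : ℝ × ℝ => G L p.1 p.2 * E L c p.2 p.1)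
      ((volume.restrict (Ioi 0)).prod volume) := by
  have hk : Integrable (fun x : ℝ => Real.exp (-4 * L * x)) (volume.restrict (Ioi 0)) :=
    integrableOn_exp_mul_Ioi (by linarith) 0
  have h := ((hk.convolution_integrand (ContinuousLinearMap.mul ℝ ℝ)
    (integrable_G_mul_exp hL (-2 * L))).swap).const_mul
      (Real.exp (-4 * L ^ 3 / 3 - 4 * L * c))
  have hE := measurable_E L c
  refine h.mono' (((continuous_G L).measurable.mul
    (hE.comp measurable_swap)).aestronglyMeasurable) (ae_of_all _ fun p => ?_)
  simp only [Function.comp_apply, Prod.fst_swap, Prod.snd_swap, ContinuousLinearMap.mul_apply']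
  rw [norm_mul, Real.norm_of_nonneg (G_nonneg hL _ _), Real.norm_eq_abs, G_eq_sub]
  refine (mul_le_mul_of_nonneg_left (abs_E_le hL c _ _) (G_nonneg hL _ _)).trans_eq ?_
  rw [show -2 * L * (p.2 + p.1) = -4 * L * p.1 + -2 * L * (p.2 - p.1) by ring, Real.exp_add]
  ring

lemma integral_G_mul_E_comm {L : ℝ} (hL : 1 ≤ L) (c x : ℝ) :
    ∫ z, G L x z * E L c z x = Ai (2 * x + 2 * c) := by
  rw [show 2 * x + 2 * c = 2 * (c + (x + x) / 2) by ring, ← integral_G_mul_E hL,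
    ← integral_sub_right_eq_self (fun s => G L 0 s * E L (c + (x + x) / 2) 0 s) x]
  congr 1
  ext z
  rw [← G_eq_sub, ← E_add_right, E_eq_zero_add, show z - x + (x + x) = z + x by ring]

lemma integrable_id_mul_G_mul_E {L : ℝ} (hL : 1 ≤ L) (c : ℝ) :
    Integrable (fun s => s * (G L 0 s * E L c 0 s)) := by
  refine ((integrable_id_mul_G_mul_exp hL (-2 * L)).norm.const_mul
    (Real.exp (-4 * L ^ 3 / 3 - 4 * L * c))).mono' ?_ (ae_of_all _ fun s => ?_)
  · exact (measurable_id.mul ((continuous_G_right L 0).measurable.mul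
      ((measurable_E L c).comp (by fun_prop : Measurable fun s : ℝ => ((0 : ℝ), s))))
        ).aestronglyMeasurable
  · have := abs_E_le hL c 0 s
    rw [zero_add] at this
    rw [norm_mul, norm_mul, norm_mul, norm_mul, Real.norm_of_nonneg (Real.exp_pos _).le,
      Real.norm_eq_abs (E L c 0 s)]
    calc _ ≤ ‖s‖ * (‖G L 0 s‖ * (Real.exp (-4 * L ^ 3 / 3 - 4 * L * c) *
          Real.exp (-2 * L * s))) := by gcongr
      _ = _ := by ring

lemma integral_exp_neg_two_mul_Ioi : ∫ x in Ioi (0 : ℝ), Real.exp (-2 * x) = 1 / 2 := by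
  rw [integral_exp_mul_Ioi (by norm_num)]
  norm_num

lemma abs_integral_Ioi_Ioi_G_mul_E_le {L : ℝ} (hL : 1 ≤ L) (c : ℝ) :
    |∫ x in Ioi (0 : ℝ), ∫ z in Ioi (0 : ℝ), G L x z * E L c z x| ≤
      Real.exp (-4 * L ^ 3 / 3 - 4 * L * c) / 4 := by
  have hexp : IntegrableOn (fun x : ℝ => Real.exp (-2 * x)) (Ioi 0) :=
    integrableOn_exp_mul_Ioi (by norm_num) 0
  set M := Real.exp (-4 * L ^ 3 / 3 - 4 * L * c) with hM
  have hinner : ∀ x ∈ Ioi (0 : ℝ), ‖∫ z in Ioi (0 : ℝ), G L x z * E L c z x‖ ≤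
      M / 2 * Real.exp (-2 * x) := by
    intro x hx
    rw [show M / 2 * Real.exp (-2 * x) =
      ∫ z in Ioi (0 : ℝ), M * Real.exp (-2 * x) * Real.exp (-2 * z) by
        rw [integral_const_mul, integral_exp_neg_two_mul_Ioi]; ring]
    refine norm_integral_le_of_norm_le (hexp.const_mul _)
      ((ae_restrict_iff' measurableSet_Ioi).2 (ae_of_all _ fun z hz => ?_))
    rw [norm_mul, Real.norm_of_nonneg (G_nonneg hL _ _), Real.norm_eq_abs]
    have h1 := mul_le_mul (G_le_one hL x z) (abs_E_le hL c z x) (abs_nonneg _) zero_le_one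
    refine h1.trans ?_
    rw [one_mul, ← hM, mul_assoc M, ← Real.exp_add (-2 * x)]
    gcongr
    nlinarith [mem_Ioi.1 hx, mem_Ioi.1 hz]
  have := norm_integral_le_of_norm_le (hexp.const_mul (M / 2))
      ((ae_restrict_iff' measurableSet_Ioi).2 (ae_of_all _ hinner))
  rw [integral_const_mul, integral_exp_neg_two_mul_Ioi] at this
  rw [← Real.norm_eq_abs]
  linarith

lemma abs_integral_Ioi_id_mul_G_mul_E_le {L : ℝ} (hL : 1 ≤ L) (c : ℝ) :
    |∫ s in Ioi (0 : ℝ), s * (G L 0 s * E L c 0 s)| ≤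
      Real.exp (-4 * L ^ 3 / 3 - 4 * L * c) := by
  have hexp : IntegrableOn (fun x : ℝ => Real.exp (-1 * x)) (Ioi 0) :=
    integrableOn_exp_mul_Ioi (by norm_num) 0
  set M := Real.exp (-4 * L ^ 3 / 3 - 4 * L * c) with hM
  have := norm_integral_le_of_norm_le (f := fun s => s * (G L 0 s * E L c 0 s))
      (hexp.const_mul M)
      ((ae_restrict_iff' measurableSet_Ioi).2 (ae_of_all _ fun s hs => by
        have hs0 : 0 < s := hs
        rw [norm_mul, norm_mul, Real.norm_of_nonneg (G_nonneg hL _ _), Real.norm_eq_abs (E _ _ _ _),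
          Real.norm_of_nonneg hs0.le]
        have h1 := mul_le_mul (G_le_one hL 0 s) (abs_E_le hL c 0 s) (abs_nonneg _) zero_le_one
        have h2 : s ≤ Real.exp s := by linarith [Real.add_one_le_exp s]
        refine (mul_le_mul h2 h1 (mul_nonneg (G_nonneg hL _ _) (abs_nonneg _))
          (Real.exp_pos _).le).trans ?_
        rw [one_mul, mul_left_comm, ← Real.exp_add]
        gcongr
        nlinarith))
  rw [integral_const_mul, integral_exp_mul_Ioi (by norm_num)] at this
  rw [← Real.norm_eq_abs]
  simpa using this

/-- The trace of `K` splits into integrals over the half-lines. -/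
lemma integral_K_diag {L : ℝ} (hL : 1 ≤ L) (c : ℝ) :
    ∫ x, K L c x x = 2 * (∫ x in Ioi (0 : ℝ), Ai (2 * x + 2 * c)) - 2 * L * Ai' (2 * c) -
      (∫ x in Ioi (0 : ℝ), ∫ z in Ioi (0 : ℝ), G L x z * E L c z x) +
      ∫ s in Ioi (0 : ℝ), s * (G L 0 s * E L c 0 s) := by
  have hprod := integrable_G_mul_E_prod hL c
  have hAi : IntegrableOn (fun x => Ai (2 * x + 2 * c)) (Ioi 0) := by
    have := hprod.integral_prod_left
    simp_rw [integral_G_mul_E_comm hL] at this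
    exact this
  have hprod₁ : Integrable (fun p : ℝ × ℝ => G L p.1 p.2 * E L c p.2 p.1)
      ((volume.restrict (Ioi 0)).prod (volume.restrict (Ioi 0))) :=
    hprod.mono_measure (Measure.prod_mono le_rfl Measure.restrict_le_self)
  have hprod₂ : Integrable (fun p : ℝ × ℝ => G L p.1 p.2 * E L c p.2 p.1)
      ((volume.restrict (Ioi 0)).prod (volume.restrict (Iic 0))) :=
    hprod.mono_measure (Measure.prod_mono le_rfl Measure.restrict_le_self)
  have hsplit : ∫ x in Ioi (0 : ℝ), Ai (2 * x + 2 * c) =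
      (∫ x in Ioi (0 : ℝ), ∫ z in Iic (0 : ℝ), G L x z * E L c z x) +
        ∫ x in Ioi (0 : ℝ), ∫ z in Ioi (0 : ℝ), G L x z * E L c z x := by
    rw [← integral_add hprod₂.integral_prod_left hprod₁.integral_prod_left]
    refine integral_congr_ae ?_
    filter_upwards [hprod.prod_right_ae] with x hx
    rw [← integral_G_mul_E_comm hL, ← integral_add_compl measurableSet_Iic hx, compl_Iic]
  have hsymm : ∀ x z : ℝ, G L z x * E L c x z = G L x z * E L c z x := by
    intro x z
    rw [G_comm, E_eq_zero_add, E_eq_zero_add L c z x, add_comm]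
  have hswap : ∫ x in Ioi (0 : ℝ), ∫ z in Iic (0 : ℝ), G L x z * E L c z x =
      ∫ x in Iic (0 : ℝ), ∫ z in Ioi (0 : ℝ), G L x z * E L c z x := by
    rw [integral_integral_swap hprod₂]
    simp_rw [hsymm]
  have hT₂ : IntegrableOn (fun x => ∫ z in Ioi (0 : ℝ), G L x z * E L c z x) (Iic 0) := by
    have := hprod₂.integral_prod_right
    simp_rw [hsymm] at this
    exact this
  have hid := integrable_id_mul_G_mul_E hL c
  obtain ⟨hT₃, hT₃_eq⟩ := integral_Iic_Iic_add (f := fun s => G L 0 s * E L c 0 s)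
    ((continuous_G_right L 0).measurable.mul
      ((measurable_E L c).comp (by fun_prop : Measurable fun s : ℝ => ((0 : ℝ), s)))
        ).aestronglyMeasurable hid
  have hrefl : ∀ x z : ℝ, G L 0 (x + z) * E L c 0 (x + z) = G L (-x) z * E L c z x := by
    intro x z
    rw [G_eq_sub L (-x), E_eq_zero_add L c z, sub_neg_eq_add, add_comm z]
  simp_rw [hrefl] at hT₃ hT₃_eq
  have hderiv : ∫ s in Iic (0 : ℝ), -s * (G L 0 s * E L c 0 s) =
      -(2 * L * Ai' (2 * c)) + ∫ s in Ioi (0 : ℝ), s * (G L 0 s * E L c 0 s) := by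
    have hneg : Integrable (fun s => -s * (G L 0 s * E L c 0 s)) := by
      simpa only [neg_mul] using hid.fun_neg
    rw [← integral_neg_id_mul_G_mul_E hL, ← integral_add_compl measurableSet_Iic hneg, compl_Iic]
    simp only [neg_mul, integral_neg]
    ring
  have hpos : ∀ x ∈ Ioi (0 : ℝ), Ai (2 * x + 2 * c) = K L c x x := by
    intro x hx
    have hx0 : 0 < x := hx
    simp [K, hx0, hx0.not_ge, two_mul]
  have hneg : ∀ x ∈ Iic (0 : ℝ), (∫ z in Ioi (0 : ℝ), G L x z * E L c z x) +
      (∫ z in Iic (0 : ℝ), G L (-x) z * E L c z x) = K L c x x := by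
    intro x hx
    have hx0 : x ≤ 0 := hx
    simp [K, hx0, hx0.not_gt]
  have hKpos : IntegrableOn (fun x => K L c x x) (Ioi 0) :=
    hAi.congr_fun hpos measurableSet_Ioi
  have hKneg : IntegrableOn (fun x => K L c x x) (Iic 0) :=
    IntegrableOn.congr_fun (hT₂.add hT₃) hneg measurableSet_Iic
  have hK : Integrable (fun x => K L c x x) := by
    rw [← integrableOn_univ, ← Iic_union_Ioi (a := (0 : ℝ))]
    exact hKneg.union hKpos
  rw [← integral_add_compl measurableSet_Iic hK, compl_Iic,
    ← setIntegral_congr_fun measurableSet_Ioi hpos,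
    ← setIntegral_congr_fun measurableSet_Iic hneg, integral_add hT₂ hT₃, ← hswap, hT₃_eq,
    hderiv, two_mul (∫ x in Ioi (0 : ℝ), Ai (2 * x + 2 * c))]
  linear_combination -hsplit

/-- The `n = 1` trace estimate: for `c ≥ 1/2` and `L ≥ 1`,
`|Tr(K_{L,c}) - 2 Tr(P₀ B_{0,c}) + 2 L Ai'(2c)| ≤ e^{-4L³/3}`. -/
theorem trace_K_n_eq_one (c : ℝ) (hc : 1 / 2 ≤ c) (L : ℝ) (hL : 1 ≤ L) :
    |(∫ x : ℝ, K L c x x) - 2 * (∫ x in Set.Ioi (0 : ℝ), Ai (2 * x + 2 * c))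
      + 2 * L * Ai' (2 * c)| ≤ Real.exp (-4 * L ^ 3 / 3) := by
  have h1 := abs_le.1 (abs_integral_Ioi_Ioi_G_mul_E_le hL c)
  have h2 := abs_le.1 (abs_integral_Ioi_id_mul_G_mul_E_le hL c)
  have hM : 3 * Real.exp (-4 * L ^ 3 / 3 - 4 * L * c) ≤ Real.exp (-4 * L ^ 3 / 3) := by
    have h3 : (3 : ℝ) ≤ Real.exp (4 * L * c) := by
      nlinarith [Real.add_one_le_exp (4 * L * c)]
    calc 3 * Real.exp (-4 * L ^ 3 / 3 - 4 * L * c)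
        ≤ Real.exp (4 * L * c) * Real.exp (-4 * L ^ 3 / 3 - 4 * L * c) := by gcongr
      _ = Real.exp (-4 * L ^ 3 / 3) := by rw [← Real.exp_add]; congr 1; ring
  have hpos := Real.exp_pos (-4 * L ^ 3 / 3 - 4 * L * c)
  rw [integral_K_diag hL c, abs_le]
  constructor <;> linarith [h1.1, h1.2, h2.1, h2.2]
end

section
/- For every α ∈ (0,1) there exist δ > 0 and L₀ ≥ 1 such that for all L ≥ L₀, ∑_{n=1}^∞ (1/n)·α^n·exp(−4L³/(3n²)) ≤ exp(−δ·L). -/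
/-- An exponential decay rate in `m` and a factor `exp (-4 L³ / (3 m²))` together give decay in `L`:
the geometric factor wins when `L ≤ m`, the other one when `m ≤ L`. -/
lemma min_mul_le_mul_add_cube_div {c m L : ℝ} (hc : 0 < c) (hm : 0 < m) (hL : 0 < L) :
    min c 1 * L ≤ c * m + 4 * L ^ 3 / (3 * m ^ 2) := by
  rcases le_total L m with h | h
  · have h₁ : min c 1 * L ≤ c * m :=
      mul_le_mul (min_le_left _ _) h hL.le hc.le
    have h₂ : 0 ≤ 4 * L ^ 3 / (3 * m ^ 2) := by positivity
    linarith
  · have h₁ : min c 1 * L ≤ L := mul_le_of_le_one_left hL.le (min_le_right _ _)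
    have h₂ : L ≤ 4 * L ^ 3 / (3 * m ^ 2) := by
      rw [le_div_iff₀ (by positivity)]
      have h₃ : m ^ 2 ≤ L ^ 2 := by gcongr
      nlinarith [mul_le_mul_of_nonneg_left h₃ hL.le, pow_pos hL 3]
    have h₄ : 0 < c * m := by positivity
    linarith

open Real in
lemma error_series_term_le {c L : ℝ} (hc : 0 < c) (hL : 0 < L) (n : ℕ) :
    (1 / ((n : ℝ) + 1)) * exp (-(2 * c)) ^ (n + 1) * exp (-4 * L ^ 3 / (3 * ((n : ℝ) + 1) ^ 2)) ≤
      exp (-c) ^ n * exp (-(min c 1 * L)) := by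
  have hm : (0 : ℝ) < (n : ℝ) + 1 := by positivity
  have hone : 1 / ((n : ℝ) + 1) ≤ 1 := by
    rw [div_le_one hm]
    linarith [n.cast_nonneg (α := ℝ)]
  rw [mul_assoc]
  refine (mul_le_of_le_one_left (by positivity) hone).trans ?_
  rw [← exp_nat_mul, ← exp_nat_mul, ← exp_add, ← exp_add, exp_le_exp]
  have key := min_mul_le_mul_add_cube_div hc hm hL
  have hneg : -4 * L ^ 3 / (3 * ((n : ℝ) + 1) ^ 2) =
      -(4 * L ^ 3 / (3 * ((n : ℝ) + 1) ^ 2)) := by ring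
  rw [hneg]
  push_cast
  nlinarith

/-- For every `α ∈ (0,1)` there exist `δ > 0` and `L₀ ≥ 1` such that for all `L ≥ L₀`,
`∑_{n≥1} (1/n) αⁿ exp(-4L³/(3n²)) ≤ exp(-δL)`. -/
theorem error_series_bound (α : ℝ) (hα : α ∈ Set.Ioo (0 : ℝ) 1) :
    ∃ δ : ℝ, 0 < δ ∧ ∃ L₀ : ℝ, 1 ≤ L₀ ∧ ∀ L, L₀ ≤ L →
      (∑' n : ℕ, (1 / ((n : ℝ) + 1)) * α ^ (n + 1) *
        Real.exp (-4 * L ^ 3 / (3 * ((n : ℝ) + 1) ^ 2))) ≤ Real.exp (-δ * L) := by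
  obtain ⟨hα₀, hα₁⟩ := hα
  obtain ⟨c, hc, rfl⟩ : ∃ c : ℝ, 0 < c ∧ Real.exp (-(2 * c)) = α := by
    refine ⟨-Real.log α / 2, by linarith [Real.log_neg hα₀ hα₁], ?_⟩
    rw [show -(2 * (-Real.log α / 2)) = Real.log α by ring, Real.exp_log hα₀]
  have hr₁ : Real.exp (-c) < 1 := by simpa using hc
  set C : ℝ := (1 - Real.exp (-c))⁻¹
  set γ : ℝ := min c 1
  have hγ₀ : 0 < γ := lt_min hc one_pos
  refine ⟨γ / 2, by positivity, max 1 (2 * C / γ), le_max_left _ _, fun L hL ↦ ?_⟩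
  have hL₀ : 0 < L := one_pos.trans_le ((le_max_left _ _).trans hL)
  have hCL : 2 * C ≤ L * γ := (div_le_iff₀ hγ₀).mp ((le_max_right _ _).trans hL)
  have hgeom : HasSum (fun n : ℕ ↦ Real.exp (-c) ^ n * Real.exp (-(γ * L)))
      (C * Real.exp (-(γ * L))) :=
    (hasSum_geometric_of_lt_one (Real.exp_nonneg _) hr₁).mul_right _
  have hle := error_series_term_le hc hL₀
  have hsum := Summable.of_nonneg_of_le (fun n ↦ by positivity) hle hgeom.summable
  calc
    _ ≤ C * Real.exp (-(γ * L)) := hasSum_le hle hsum.hasSum hgeom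
    _ ≤ Real.exp C * Real.exp (-(γ * L)) := by
      gcongr
      linarith [Real.add_one_le_exp C]
    _ ≤ Real.exp (-(γ / 2) * L) := by
      rw [← Real.exp_add, Real.exp_le_exp]
      linarith
end

section
/- Fix an integer n ≥ 1 and define k_n : (0, π/2) → ℝ by k_n(φ) = (3πn)^{2/3}·( cos(2φ)/(6·sin(φ)^{2/3}) − sin(φ)^{4/3}/3 ). Then: (i) if w = r·e^{iφ} with r > 0 and φ ∈ (0, π/2), and c ∈ ℝ satisfy w³/3 − 2wc = 2πin, then r = (3πn/ sin φ)^{1/3} and c = k_n(φ); (ii) k_n is strictly decreasing on (0, π/2); (iii) k_n(π/3) = −(2nπ/3)^{2/3}. Consequently, any solution w = r·e^{iφ} (r > 0, 0 < φ < π/2) of w³/3 − 2wc = 2πin has φ > π/3 when c < −(2nπ/3)^{2/3}, and φ < π/3 when −(2nπ/3)^{2/3} < c < 0. -/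
/-- The function `k_n(φ) = (3πn)^{2/3}·( cos(2φ)/(6·sin(φ)^{2/3}) − sin(φ)^{4/3}/3 )`. -/
noncomputable def kFun (n : ℕ) (φ : ℝ) : ℝ :=
  (3 * Real.pi * n) ^ ((2 : ℝ) / 3) *
    (Real.cos (2 * φ) / (6 * Real.sin φ ^ ((2 : ℝ) / 3)) - Real.sin φ ^ ((4 : ℝ) / 3) / 3)

theorem rpow_two_thirds_pow_three {x : ℝ} (hx : 0 ≤ x) : (x ^ ((2 : ℝ) / 3)) ^ 3 = x ^ 2 := by
  rw [← Real.rpow_natCast, ← Real.rpow_mul hx, ← Real.rpow_natCast]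
  norm_num

theorem pow_three_rpow_two_thirds {x : ℝ} (hx : 0 ≤ x) : (x ^ 3) ^ ((2 : ℝ) / 3) = x ^ 2 := by
  rw [← Real.rpow_natCast, ← Real.rpow_mul hx, ← Real.rpow_natCast]
  norm_num

theorem pow_three_rpow_one_third {x : ℝ} (hx : 0 ≤ x) : (x ^ 3) ^ ((1 : ℝ) / 3) = x := by
  rw [← Real.rpow_natCast, ← Real.rpow_mul hx]
  norm_num

theorem sin_pos_of_mem_Ioo_pi_div_two {φ : ℝ} (hφ : φ ∈ Set.Ioo 0 (Real.pi / 2)) :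
    0 < Real.sin φ :=
  Real.sin_pos_of_pos_of_lt_pi hφ.1 (by linarith [hφ.2, Real.pi_pos])

/-- `kFun` as a rational function of `sin φ ^ (2 / 3)`. -/
theorem kFun_eq (n : ℕ) {φ : ℝ} (hs : 0 < Real.sin φ) :
    kFun n φ = (3 * Real.pi * n) ^ ((2 : ℝ) / 3) *
      (1 / (6 * Real.sin φ ^ ((2 : ℝ) / 3)) - 2 / 3 * (Real.sin φ ^ ((2 : ℝ) / 3)) ^ 2) := by
  have h4 : Real.sin φ ^ ((4 : ℝ) / 3) = (Real.sin φ ^ ((2 : ℝ) / 3)) ^ 2 := by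
    rw [← Real.rpow_natCast, ← Real.rpow_mul hs.le]
    norm_num
  have hc : Real.cos (2 * φ) = 1 - 2 * (Real.sin φ ^ ((2 : ℝ) / 3)) ^ 3 := by
    rw [rpow_two_thirds_pow_three hs.le, Real.cos_two_mul, Real.cos_sq']
    ring
  have ht : 0 < Real.sin φ ^ ((2 : ℝ) / 3) := Real.rpow_pos_of_pos hs _
  rw [kFun, h4, hc]
  field_simp
  ring

theorem kFun_strictAntiOn {n : ℕ} (hn : 1 ≤ n) :
    StrictAntiOn (kFun n) (Set.Ioo 0 (Real.pi / 2)) := by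
  intro a ha b hb hab
  have hsa := sin_pos_of_mem_Ioo_pi_div_two ha
  have hsb := sin_pos_of_mem_Ioo_pi_div_two hb
  have hlt : Real.sin a < Real.sin b :=
    Real.sin_lt_sin_of_lt_of_le_pi_div_two (by linarith [ha.1, Real.pi_pos]) hb.2.le hab
  rw [kFun_eq n hsa, kFun_eq n hsb]
  have ht : Real.sin a ^ ((2 : ℝ) / 3) < Real.sin b ^ ((2 : ℝ) / 3) :=
    Real.rpow_lt_rpow hsa.le hlt (by norm_num)
  have hta : 0 < Real.sin a ^ ((2 : ℝ) / 3) := Real.rpow_pos_of_pos hsa _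
  have hn' : (0 : ℝ) < n := by exact_mod_cast hn
  gcongr

theorem kFun_pi_div_three (n : ℕ) :
    kFun n (Real.pi / 3) = -(2 * (n : ℝ) * Real.pi / 3) ^ ((2 : ℝ) / 3) := by
  have hs : 0 < Real.sin (Real.pi / 3) := by
    rw [Real.sin_pi_div_three]
    positivity
  have ht : 0 < Real.sin (Real.pi / 3) ^ ((2 : ℝ) / 3) := Real.rpow_pos_of_pos hs _
  have ht3 : (Real.sin (Real.pi / 3) ^ ((2 : ℝ) / 3)) ^ 3 = 3 / 4 := by
    rw [rpow_two_thirds_pow_three hs.le, Real.sin_pi_div_three, div_pow, Real.sq_sqrt (by norm_num)]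
    norm_num
  have hA3 : ((3 * Real.pi * n) ^ ((2 : ℝ) / 3)) ^ 3 = (3 * Real.pi * n) ^ 2 :=
    rpow_two_thirds_pow_three (by positivity)
  have hA : 0 ≤ (3 * Real.pi * n) ^ ((2 : ℝ) / 3) := by positivity
  rw [kFun_eq n hs]
  generalize Real.sin (Real.pi / 3) ^ ((2 : ℝ) / 3) = t at *
  generalize (3 * Real.pi * n) ^ ((2 : ℝ) / 3) = A at *
  have hroot : (2 * (n : ℝ) * Real.pi / 3) ^ ((2 : ℝ) / 3) = A / (3 * t) := by
    refine (pow_left_inj₀ (by positivity) (by positivity) (three_ne_zero)).1 ?_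
    rw [rpow_two_thirds_pow_three (by positivity), div_pow A, mul_pow 3 t, ht3, hA3]
    ring
  rw [hroot]
  field_simp
  linear_combination (-12 * A) * ht3

theorem modulus_and_parameter_of_eq {n : ℕ} {r φ c : ℝ} (hr : 0 < r)
    (hφ : φ ∈ Set.Ioo 0 (Real.pi / 2))
    (h : ((r : ℂ) * Complex.exp ((φ : ℝ) * Complex.I)) ^ 3 / 3
          - 2 * ((r : ℂ) * Complex.exp ((φ : ℝ) * Complex.I)) * (c : ℂ)
        = 2 * (Real.pi : ℂ) * (n : ℂ) * Complex.I) :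
    r = (3 * Real.pi * n / Real.sin φ) ^ ((1 : ℝ) / 3) ∧ c = kFun n φ := by
  have hs := sin_pos_of_mem_Ioo_pi_div_two hφ
  have hcos : 0 < Real.cos φ :=
    Real.cos_pos_of_mem_Ioo ⟨by linarith [hφ.1, Real.pi_pos], hφ.2⟩
  have hre : r ^ 3 * (Real.cos φ ^ 3 - 3 * Real.cos φ * Real.sin φ ^ 2) / 3
      - 2 * r * c * Real.cos φ = 0 := by
    have := congrArg Complex.re h
    rw [Complex.exp_mul_I, ← Complex.ofReal_cos, ← Complex.ofReal_sin] at this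
    simp [pow_succ, -Complex.ofReal_cos, -Complex.ofReal_sin] at this
    linear_combination this
  have him : r ^ 3 * (3 * Real.cos φ ^ 2 * Real.sin φ - Real.sin φ ^ 3) / 3
      - 2 * r * c * Real.sin φ = 2 * Real.pi * n := by
    have := congrArg Complex.im h
    rw [Complex.exp_mul_I, ← Complex.ofReal_cos, ← Complex.ofReal_sin] at this
    simp [pow_succ, -Complex.ofReal_cos, -Complex.ofReal_sin] at this
    linear_combination this
  have hsq := Real.sin_sq_add_cos_sq φ
  have hc : c = r ^ 2 * (1 - 4 * Real.sin φ ^ 2) / 6 := by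
    have : 2 * r * Real.cos φ * (c - r ^ 2 * (1 - 4 * Real.sin φ ^ 2) / 6) = 0 := by
      linear_combination -hre + r ^ 3 * Real.cos φ / 3 * hsq
    have hne : 2 * r * Real.cos φ ≠ 0 := by positivity
    linarith [(mul_eq_zero.1 this).resolve_left hne]
  have hr3 : r ^ 3 * Real.sin φ = 3 * Real.pi * n := by
    rw [hc] at him
    linear_combination 3 / 2 * him - 3 / 2 * r ^ 3 * Real.sin φ * hsq
  constructor
  · rw [← hr3, mul_div_cancel_right₀ _ hs.ne', pow_three_rpow_one_third hr.le]
  · have ht : 0 < Real.sin φ ^ ((2 : ℝ) / 3) := Real.rpow_pos_of_pos hs _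
    rw [kFun_eq n hs, ← hr3, Real.mul_rpow (by positivity) hs.le,
      pow_three_rpow_two_thirds hr.le, hc, ← rpow_two_thirds_pow_three hs.le]
    field_simp
    ring

/-- Solutions of `w³/3 - 2wc = 2πin` with `w = r e^{iφ}`, `r > 0`, `0 < φ < π/2`, satisfy
`r = (3πn/sin φ)^{1/3}` and `c = k_n(φ)`; `k_n` is strictly decreasing on `(0, π/2)` with
`k_n(π/3) = -(2nπ/3)^{2/3}`; consequently the solutions have `φ > π/3` for
`c < -(2nπ/3)^{2/3}` and `φ < π/3` for `-(2nπ/3)^{2/3} < c < 0`. -/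
theorem pole_location (n : ℕ) (hn : 1 ≤ n) :
    (∀ r φ c : ℝ, 0 < r → φ ∈ Set.Ioo 0 (Real.pi / 2) →
      ((r : ℂ) * Complex.exp ((φ : ℝ) * Complex.I)) ^ 3 / 3
          - 2 * ((r : ℂ) * Complex.exp ((φ : ℝ) * Complex.I)) * (c : ℂ)
        = 2 * (Real.pi : ℂ) * (n : ℂ) * Complex.I →
      r = (3 * Real.pi * n / Real.sin φ) ^ ((1 : ℝ) / 3) ∧ c = kFun n φ) ∧
    StrictAntiOn (kFun n) (Set.Ioo 0 (Real.pi / 2)) ∧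
    kFun n (Real.pi / 3) = -(2 * (n : ℝ) * Real.pi / 3) ^ ((2 : ℝ) / 3) ∧
    (∀ r φ c : ℝ, 0 < r → φ ∈ Set.Ioo 0 (Real.pi / 2) →
      ((r : ℂ) * Complex.exp ((φ : ℝ) * Complex.I)) ^ 3 / 3
          - 2 * ((r : ℂ) * Complex.exp ((φ : ℝ) * Complex.I)) * (c : ℂ)
        = 2 * (Real.pi : ℂ) * (n : ℂ) * Complex.I →
      (c < -(2 * (n : ℝ) * Real.pi / 3) ^ ((2 : ℝ) / 3) → Real.pi / 3 < φ) ∧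
      (-(2 * (n : ℝ) * Real.pi / 3) ^ ((2 : ℝ) / 3) < c → c < 0 → φ < Real.pi / 3)) := by
  have hmem : Real.pi / 3 ∈ Set.Ioo 0 (Real.pi / 2) :=
    ⟨by linarith [Real.pi_pos], by linarith [Real.pi_pos]⟩
  refine ⟨fun r φ c hr hφ h => modulus_and_parameter_of_eq hr hφ h, kFun_strictAntiOn hn,
    kFun_pi_div_three n, fun r φ c hr hφ h => ?_⟩
  rw [(modulus_and_parameter_of_eq hr hφ h).2, ← kFun_pi_div_three n]
  exact ⟨fun hlt => ((kFun_strictAntiOn hn).lt_iff_gt hφ hmem).1 hlt,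
    fun hlt _ => ((kFun_strictAntiOn hn).lt_iff_gt hmem hφ).1 hlt⟩
end

section
/- Let n ≥ 1 be an integer, c(n) = −(2πn/3)^{2/3} and w(n) = √3·(2πn/3)^{1/3}·exp(iπ/3). Then w ↦ w²·exp(w³/3 − 2w·c(n))/(1 − exp(w³/3 − 2w·c(n))) has simple poles at w(n) and at its conjugate w̄(n), with lim_{w → w(n)} (w − w(n))·w²·exp(w³/3 − 2w·c(n))/(1 − exp(w³/3 − 2w·c(n))) = (−6 − 3√3·i)/7, and the sum of this limit and the corresponding limit at w̄(n) equals −12/7. (With the paper's normalization factor 4, this is the residue contribution of 48/7 across each threshold c(n) in the analytic continuation of κ′.) -/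
open Filter

/-- The thresholds `c(n) = -(2πn/3)^{2/3}`. -/
noncomputable def cPt (n : ℕ) : ℝ := -(2 * Real.pi * n / 3) ^ ((2 : ℝ) / 3)

/-- The points `w(n) = √3·(2πn/3)^{1/3}·e^{iπ/3}`. -/
noncomputable def wPt (n : ℕ) : ℂ :=
  (Real.sqrt 3 * (2 * Real.pi * n / 3) ^ ((1 : ℝ) / 3) : ℝ) *
    Complex.exp ((Real.pi / 3 : ℝ) * Complex.I)

/-- If `exp (z³/3 - 2zc) = 1` and `z² - 2c ≠ 0`, then `w² e^{w³/3-2wc}/(1-e^{w³/3-2wc})` has a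
simple pole at `z`, with residue `z² / (-(z² - 2c))`. -/
theorem tendsto_sub_mul_exp_div_one_sub_exp {z c : ℂ}
    (hz : Complex.exp (z ^ 3 / 3 - 2 * z * c) = 1) (hd : z ^ 2 - 2 * c ≠ 0) :
    Tendsto (fun w : ℂ =>
        (w - z) * (w ^ 2 * Complex.exp (w ^ 3 / 3 - 2 * w * c) /
          (1 - Complex.exp (w ^ 3 / 3 - 2 * w * c))))
      (nhdsWithin z {z}ᶜ) (nhds (z ^ 2 / (-(z ^ 2 - 2 * c)))) := by
  have hphase : HasDerivAt (fun w : ℂ => w ^ 3 / 3 - 2 * w * c) (z ^ 2 - 2 * c) z := by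
    have h := ((hasDerivAt_pow 3 z).div_const 3).sub
      (((hasDerivAt_id z).const_mul 2).mul_const c)
    refine h.congr_deriv ?_
    norm_num
  have hden : HasDerivAt (fun w : ℂ => 1 - Complex.exp (w ^ 3 / 3 - 2 * w * c))
      (-(z ^ 2 - 2 * c)) z := by
    refine (hphase.cexp.const_sub 1).congr_deriv ?_
    rw [hz, one_mul]
  have hslope := (hasDerivAt_iff_tendsto_slope.mp hden).inv₀ (neg_ne_zero.mpr hd)
  have hnum : Tendsto (fun w : ℂ => w ^ 2 * Complex.exp (w ^ 3 / 3 - 2 * w * c))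
      (nhdsWithin z {z}ᶜ) (nhds (z ^ 2)) := by
    have hcont : Continuous (fun w : ℂ => w ^ 2 * Complex.exp (w ^ 3 / 3 - 2 * w * c)) := by
      fun_prop
    have h := (hcont.tendsto z).mono_left (nhdsWithin_le_nhds (s := {z}ᶜ))
    rwa [hz, mul_one] at h
  refine (hnum.mul hslope).congr fun w => ?_
  rw [slope_def_field, hz, sub_self, sub_zero, inv_div]
  ring

theorem wPt_eq (n : ℕ) :
    wPt n = (Real.sqrt 3 : ℂ) * (((2 * Real.pi * n / 3) ^ ((1 : ℝ) / 3) : ℝ) : ℂ) *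
      (1 / 2 + (Real.sqrt 3 : ℂ) / 2 * Complex.I) := by
  rw [wPt, Complex.exp_mul_I, ← Complex.ofReal_cos, ← Complex.ofReal_sin,
    Real.cos_pi_div_three, Real.sin_pi_div_three]
  push_cast
  ring

theorem cPt_eq (n : ℕ) : cPt n = -((2 * Real.pi * n / 3) ^ ((1 : ℝ) / 3)) ^ 2 := by
  rw [cPt, ← Real.rpow_mul_natCast (by positivity)]
  norm_num

theorem ofReal_sqrt_three_sq : (Real.sqrt 3 : ℂ) ^ 2 = 3 := by
  rw [← Complex.ofReal_pow, Real.sq_sqrt (by norm_num)]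
  norm_num

theorem wPt_phase (n : ℕ) :
    wPt n ^ 3 / 3 - 2 * wPt n * (cPt n : ℂ) = n * (2 * Real.pi * Complex.I) := by
  have hcube : (((2 * Real.pi * n / 3) ^ ((1 : ℝ) / 3) : ℝ) : ℂ) ^ 3 = 2 * Real.pi * n / 3 := by
    rw [← Complex.ofReal_pow, ← Real.rpow_mul_natCast (by positivity)]
    norm_num
  rw [wPt_eq, cPt_eq]
  push_cast
  generalize (((2 * Real.pi * n / 3) ^ ((1 : ℝ) / 3) : ℝ) : ℂ) = a at hcube ⊢
  have hs := ofReal_sqrt_three_sq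
  generalize (Real.sqrt 3 : ℂ) = s at hs ⊢
  have hI := Complex.I_sq
  grind

theorem wPt_sq (n : ℕ) :
    wPt n ^ 2 = (((2 * Real.pi * n / 3) ^ ((1 : ℝ) / 3) : ℝ) : ℂ) ^ 2 *
      (3 * (-1 + (Real.sqrt 3 : ℂ) * Complex.I) / 2) := by
  rw [wPt_eq]
  have hs := ofReal_sqrt_three_sq
  have hI := Complex.I_sq
  grind

theorem wPt_phase_deriv (n : ℕ) :
    wPt n ^ 2 - 2 * (cPt n : ℂ) = (((2 * Real.pi * n / 3) ^ ((1 : ℝ) / 3) : ℝ) : ℂ) ^ 2 *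
      ((1 + 3 * (Real.sqrt 3 : ℂ) * Complex.I) / 2) := by
  rw [wPt_sq, cPt_eq]
  push_cast
  ring

theorem wPt_phase_deriv_ne_zero {n : ℕ} (hn : 1 ≤ n) : wPt n ^ 2 - 2 * (cPt n : ℂ) ≠ 0 := by
  have ha : (2 * Real.pi * n / 3) ^ ((1 : ℝ) / 3) ≠ 0 := by
    have : (0 : ℝ) < n := by exact_mod_cast hn
    positivity
  rw [wPt_phase_deriv]
  refine mul_ne_zero (pow_ne_zero 2 (Complex.ofReal_ne_zero.mpr ha)) fun h => ?_
  have hre := congrArg Complex.re h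
  norm_num at hre

theorem wPt_residue {n : ℕ} (hn : 1 ≤ n) :
    wPt n ^ 2 / (-(wPt n ^ 2 - 2 * (cPt n : ℂ))) =
      (-6 - 3 * (Real.sqrt 3 : ℂ) * Complex.I) / 7 := by
  rw [div_eq_iff (neg_ne_zero.mpr (wPt_phase_deriv_ne_zero hn)), wPt_phase_deriv, wPt_sq]
  have hs := ofReal_sqrt_three_sq
  have hI := Complex.I_sq
  grind

/-- For `n ≥ 1` and `c = c(n)`, the function `w ↦ w² e^{w³/3-2wc}/(1-e^{w³/3-2wc})` has
simple poles at `w(n)` and its conjugate; the limit of `(w - w(n))·(…)` at `w(n)` equals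
`(-6 - 3√3 i)/7`, and the sum of the two limits equals `-12/7`. -/
theorem residues_at_cn (n : ℕ) (hn : 1 ≤ n) :
    Tendsto (fun w : ℂ =>
        (w - wPt n) * (w ^ 2 * Complex.exp (w ^ 3 / 3 - 2 * w * (cPt n : ℂ)) /
          (1 - Complex.exp (w ^ 3 / 3 - 2 * w * (cPt n : ℂ)))))
      (nhdsWithin (wPt n) {wPt n}ᶜ)
      (nhds ((-6 - 3 * (Real.sqrt 3 : ℝ) * Complex.I) / 7)) ∧
    ∃ l₂ : ℂ,
      Tendsto (fun w : ℂ =>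
          (w - (starRingEnd ℂ) (wPt n)) *
            (w ^ 2 * Complex.exp (w ^ 3 / 3 - 2 * w * (cPt n : ℂ)) /
              (1 - Complex.exp (w ^ 3 / 3 - 2 * w * (cPt n : ℂ)))))
        (nhdsWithin ((starRingEnd ℂ) (wPt n)) {(starRingEnd ℂ) (wPt n)}ᶜ) (nhds l₂) ∧
      (-6 - 3 * (Real.sqrt 3 : ℝ) * Complex.I) / 7 + l₂ = -12 / 7 := by
  have hexp : Complex.exp (wPt n ^ 3 / 3 - 2 * wPt n * (cPt n : ℂ)) = 1 := by
    rw [wPt_phase, Complex.exp_nat_mul_two_pi_mul_I]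
  have hd := wPt_phase_deriv_ne_zero hn
  have hres := wPt_residue hn
  refine ⟨hres ▸ tendsto_sub_mul_exp_div_one_sub_exp hexp hd, _,
    tendsto_sub_mul_exp_div_one_sub_exp ?_ ?_, ?_⟩
  · simpa [← Complex.exp_conj, map_ofNat] using congrArg (starRingEnd ℂ) hexp
  · simpa [map_ofNat] using (map_ne_zero (starRingEnd ℂ)).mpr hd
  · have hconj := congrArg (starRingEnd ℂ) hres
    simp only [map_div₀, map_neg, map_sub, map_mul, map_pow, Complex.conj_ofReal, Complex.conj_I,
      map_ofNat] at hconj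
    rw [hconj]
    ring
end

section
/- For every integer n ≥ 1, every c ∈ ℝ and all x, y ∈ ℝ, the (n−1)-fold convolution of translated Airy functions satisfies ∫_{ℝ^{n−1}} Ai(x − z_1 + 2c)·Ai(z_1 − z_2 + 2c)···Ai(z_{n−2} − z_{n−1} + 2c)·Ai(z_{n−1} − y + 2c) dz_1⋯dz_{n−1} = n^{−1/3}·Ai(n^{−1/3}·(x − y + 2nc)), the integral being absolutely convergent (for n = 1 the identity reads Ai(x−y+2c) = Ai(x−y+2c)). -/
open MeasureTheory

open Complex Filter Topology FourierTransform

/-- The integrand of the Airy-type contour integral with cubic coefficient `α`. -/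
noncomputable def airyIntegrand (α x : ℝ) (w : ℂ) : ℂ :=
  cexp (α * w ^ 3 / 3 - w * x)

/-- The integral of `airyIntegrand α x` along the vertical line `Re w = σ`, with respect to
the height. -/
noncomputable def airyContour (α σ x : ℝ) : ℂ :=
  ∫ t : ℝ, airyIntegrand α x (σ + t * I)

lemma norm_airyIntegrand (α x σ t : ℝ) :
    ‖airyIntegrand α x (σ + t * I)‖ =
      Real.exp (α * σ ^ 3 / 3 - σ * x) * Real.exp (-(α * σ) * t ^ 2) := by
  have h : (α : ℂ) * (σ + t * I) ^ 3 / 3 - (σ + t * I) * x =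
      ((α * σ ^ 3 / 3 - σ * x + -(α * σ) * t ^ 2 : ℝ) : ℂ) +
        ((α * (σ ^ 2 * t - t ^ 3 / 3) - t * x : ℝ) : ℂ) * I := by
    push_cast
    linear_combination ((α : ℂ) * σ * t ^ 2 + α * t ^ 3 * I / 3) * I_sq
  rw [airyIntegrand, norm_exp, h, ← Real.exp_add]
  simp only [add_re, ofReal_re, re_ofReal_mul, I_re, mul_zero, add_zero]

lemma differentiable_airyIntegrand (α x : ℝ) : Differentiable ℂ (airyIntegrand α x) := by
  unfold airyIntegrand
  fun_prop

lemma continuous_airyIntegrand (α x : ℝ) : Continuous (airyIntegrand α x) :=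
  (differentiable_airyIntegrand α x).continuous

lemma integrable_airyIntegrand {α σ : ℝ} (hα : 0 < α) (hσ : 0 < σ) (x : ℝ) :
    Integrable fun t : ℝ => airyIntegrand α x (σ + t * I) := by
  have hc := continuous_airyIntegrand α x
  refine ((integrable_exp_neg_mul_sq (mul_pos hα hσ)).const_mul
    (Real.exp (α * σ ^ 3 / 3 - σ * x))).mono' (by fun_prop) ?_
  exact .of_forall fun t => (norm_airyIntegrand α x σ t).le

lemma norm_airyContour_le (α σ x : ℝ) :
    ‖airyContour α σ x‖ ≤
      Real.exp (α * σ ^ 3 / 3) * (∫ t : ℝ, Real.exp (-(α * σ) * t ^ 2)) * Real.exp (-(σ * x)) := by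
  refine (norm_integral_le_integral_norm _).trans_eq ?_
  simp_rw [norm_airyIntegrand, integral_const_mul, sub_eq_add_neg, Real.exp_add]
  ring

lemma tendsto_integral_airyIntegrand_horizontal {α σ τ : ℝ} (hα : 0 < α) (hσ : 0 < σ)
    (hτ : 0 < τ) (x : ℝ) {ι : Type*} {l : Filter ι} {T : ι → ℝ}
    (hT : Tendsto (fun i => T i ^ 2) l atTop) :
    Tendsto (fun i => ∫ s in σ..τ, airyIntegrand α x (s + T i * I)) l (𝓝 0) := by
  set a := min σ τ
  set b := max σ τ
  have ha : 0 < a := lt_min hσ hτ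
  have hlim : Tendsto (fun i => Real.exp (α * b ^ 3 / 3 + b * |x|) *
      Real.exp (-((α * a) * T i ^ 2)) * |τ - σ|) l (𝓝 0) := by
    have := Real.tendsto_exp_neg_atTop_nhds_zero.comp (hT.const_mul_atTop (mul_pos hα ha))
    simpa using (this.const_mul (Real.exp (α * b ^ 3 / 3 + b * |x|))).mul_const |τ - σ|
  refine squeeze_zero_norm (fun i => ?_) hlim
  refine intervalIntegral.norm_integral_le_of_norm_le_const fun s hs => ?_
  have has : a ≤ s := hs.1.le
  have hsb : s ≤ b := hs.2
  have hs0 : 0 < s := ha.trans_le has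
  rw [norm_airyIntegrand, neg_mul]
  gcongr
  have : -(s * x) ≤ b * |x| := by
    calc -(s * x) = s * -x := by ring
      _ ≤ s * |x| := by gcongr; exact neg_le_abs x
      _ ≤ b * |x| := by gcongr
  have : α * s ^ 3 / 3 ≤ α * b ^ 3 / 3 := by gcongr
  linarith

lemma airyContour_eq_of_pos {α σ τ : ℝ} (hα : 0 < α) (hσ : 0 < σ) (hτ : 0 < τ) (x : ℝ) :
    airyContour α σ x = airyContour α τ x := by
  have hrect (T : ℝ) : (∫ t in (-T)..T, airyIntegrand α x (σ + t * I)) =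
      (∫ t in (-T)..T, airyIntegrand α x (τ + t * I)) - I *
        ((∫ s in σ..τ, airyIntegrand α x (s + (-T : ℝ) * I)) -
          ∫ s in σ..τ, airyIntegrand α x (s + T * I)) := by
    have h := integral_boundary_rect_eq_zero_of_differentiableOn (airyIntegrand α x)
      (σ + (-T : ℝ) * I) (τ + T * I) (differentiable_airyIntegrand α x).differentiableOn
    simp only [add_re, ofReal_re, re_ofReal_mul, I_re, mul_zero, add_zero, add_im, ofReal_im,
      im_ofReal_mul, I_im, mul_one, zero_add, smul_eq_mul] at h
    linear_combination I * h + ((∫ t in (-T)..T, airyIntegrand α x (τ + t * I)) -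
      (∫ t in (-T)..T, airyIntegrand α x (σ + t * I))) * (-I_sq)
  have hvert {ρ : ℝ} (hρ : 0 < ρ) := intervalIntegral_tendsto_integral
    (integrable_airyIntegrand hα hρ x) tendsto_neg_atTop_atBot tendsto_id
  have hsq : Tendsto (fun T : ℝ => T ^ 2) atTop atTop := tendsto_pow_atTop two_ne_zero
  have htop := tendsto_integral_airyIntegrand_horizontal hα hσ hτ x hsq
  have hbot := tendsto_integral_airyIntegrand_horizontal (T := fun T : ℝ => -T) hα hσ hτ x
    (by simpa only [neg_sq] using hsq)
  have hlim := (hvert hτ).sub ((hbot.sub htop).const_mul I)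
  simp only [sub_zero, mul_zero] at hlim
  refine tendsto_nhds_unique (hvert hσ) (hlim.congr fun T => (hrect T).symm)

lemma airyContour_pow_three {k : ℝ} (hk : 0 < k) (σ x : ℝ) :
    airyContour (k ^ 3) σ x = k⁻¹ * airyContour 1 (k * σ) (k⁻¹ * x) := by
  have h := Measure.integral_comp_mul_left
    (fun s : ℝ => airyIntegrand 1 (k⁻¹ * x) ((k * σ : ℝ) + s * I)) k
  rw [abs_of_pos (inv_pos.2 hk), real_smul, ofReal_inv] at h
  rw [airyContour, airyContour, ofReal_inv, ← h]
  congr 1 with t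
  have hk' : (k : ℂ) ≠ 0 := ofReal_ne_zero.2 hk.ne'
  simp only [airyIntegrand]
  congr 1
  push_cast
  field_simp

lemma ofReal_Ai (x : ℝ) : (Ai x : ℂ) = (2 * Real.pi : ℂ)⁻¹ * airyContour 1 1 x := by
  have hconj : (starRingEnd ℂ) (airyContour 1 1 x) = airyContour 1 1 x := by
    rw [airyContour, ← integral_conj,
      ← integral_neg_eq_self fun t : ℝ => airyIntegrand 1 x ((1 : ℝ) + t * I)]
    congr 1 with t
    simp [airyIntegrand, ← exp_conj, conj_ofNat]
  have hre : (airyContour 1 1 x).re = ∫ t : ℝ, (cexp ((1 + (t : ℂ) * I) ^ 3 / 3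
      - (1 + (t : ℂ) * I) * (x : ℂ))).re := by
    have h := integral_re (𝕜 := ℂ) (integrable_airyIntegrand one_pos one_pos x)
    simp only [RCLike.re_eq_complex_re] at h
    rw [airyContour, ← h]
    simp [airyIntegrand]
  rw [← conj_eq_iff_re.1 hconj, hre, Ai]
  push_cast
  ring

/-- `α ^ (-1/3) Ai (α ^ (-1/3) x)`, the dilation of the Airy function to cubic coefficient `α`. -/
noncomputable def scaledAi (α x : ℝ) : ℝ :=
  α ^ (-(1 : ℝ) / 3) * Ai (α ^ (-(1 : ℝ) / 3) * x)

lemma scaledAi_one (x : ℝ) : scaledAi 1 x = Ai x := by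
  simp [scaledAi]

lemma ofReal_scaledAi {α : ℝ} (hα : 0 < α) (x : ℝ) :
    (scaledAi α x : ℂ) = (2 * Real.pi : ℂ)⁻¹ * airyContour α 1 x := by
  have hk : 0 < α ^ ((1 : ℝ) / 3) := by positivity
  have hcube : (α ^ ((1 : ℝ) / 3)) ^ 3 = α := by
    rw [← Real.rpow_natCast, ← Real.rpow_mul hα.le]
    norm_num
  have hinv : α ^ (-(1 : ℝ) / 3) = (α ^ ((1 : ℝ) / 3))⁻¹ := by
    rw [← Real.rpow_neg hα.le, neg_div]
  have h := airyContour_pow_three hk 1 x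
  rw [hcube, mul_one, airyContour_eq_of_pos one_pos hk one_pos] at h
  rw [scaledAi, hinv, ofReal_mul, ofReal_Ai, h, ofReal_inv]
  ring

lemma fourier_airyIntegrand (α v : ℝ) :
    𝓕 (fun t : ℝ => airyIntegrand α 0 (1 + t * I)) v =
      Real.exp (2 * Real.pi * v) * airyContour α 1 (2 * Real.pi * v) := by
  rw [Real.fourier_real_eq_integral_exp_smul, airyContour, ← integral_const_mul]
  congr 1 with t
  simp only [airyIntegrand, smul_eq_mul, ofReal_exp, ← Complex.exp_add]
  congr 1
  push_cast
  ring

lemma continuous_fourier_airyIntegrand {α : ℝ} (hα : 0 < α) :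
    Continuous (𝓕 fun t : ℝ => airyIntegrand α 0 (1 + t * I)) :=
  VectorFourier.fourierIntegral_continuous Real.continuous_fourierChar
    (L := innerₗ ℝ) continuous_inner (by simpa using integrable_airyIntegrand hα one_pos 0)

lemma exists_norm_exp_mul_airyContour_le {α σ : ℝ} (hα : 0 < α) (hσ : 0 < σ) :
    ∃ C, ∀ x, ‖(Real.exp x : ℂ) * airyContour α 1 x‖ ≤ C * Real.exp ((1 - σ) * x) := by
  refine ⟨Real.exp (α * σ ^ 3 / 3) * ∫ t : ℝ, Real.exp (-(α * σ) * t ^ 2), fun x => ?_⟩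
  rw [norm_mul, norm_real, Real.norm_eq_abs, Real.abs_exp, airyContour_eq_of_pos hα one_pos hσ]
  refine (mul_le_mul_of_nonneg_left (norm_airyContour_le α σ x) (Real.exp_nonneg x)).trans_eq ?_
  rw [sub_mul, one_mul, sub_eq_add_neg, Real.exp_add, mul_left_comm]

lemma continuous_exp_mul_airyContour {α : ℝ} (hα : 0 < α) :
    Continuous fun x : ℝ => (Real.exp x : ℂ) * airyContour α 1 x := by
  refine ((continuous_fourier_airyIntegrand hα).comp
    (continuous_const_mul (2 * Real.pi)⁻¹)).congr fun x => ?_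
  have hpi : 2 * Real.pi * ((2 * Real.pi)⁻¹ * x) = x :=
    mul_inv_cancel_left₀ Real.two_pi_pos.ne' x
  rw [Function.comp_apply, fourier_airyIntegrand, hpi]

lemma integrable_exp_mul_airyContour {α : ℝ} (hα : 0 < α) :
    Integrable fun x : ℝ => (Real.exp x : ℂ) * airyContour α 1 x := by
  have hmeas := (continuous_exp_mul_airyContour hα).aestronglyMeasurable (μ := volume)
  obtain ⟨C, hC⟩ := exists_norm_exp_mul_airyContour_le hα (one_half_pos (α := ℝ))
  obtain ⟨D, hD⟩ := exists_norm_exp_mul_airyContour_le hα (zero_lt_two (α := ℝ))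
  rw [← integrableOn_univ, ← Set.Iic_union_Ioi (a := (0 : ℝ)), integrableOn_union]
  exact ⟨((integrableOn_exp_mul_Iic (by norm_num) 0).const_mul C).mono' hmeas.restrict
      (.of_forall hC),
    ((integrableOn_exp_mul_Ioi (by norm_num) 0).const_mul D).mono' hmeas.restrict
      (.of_forall hD)⟩

lemma integrable_fourier_airyIntegrand {α : ℝ} (hα : 0 < α) :
    Integrable (𝓕 fun t : ℝ => airyIntegrand α 0 (1 + t * I)) := by
  refine ((integrable_exp_mul_airyContour hα).comp_mul_left' Real.two_pi_pos.ne').congr ?_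
  exact .of_forall fun v => (fourier_airyIntegrand α v).symm

/-- The Fourier transform turns products into convolutions, for functions on the line for which
Fourier inversion applies. -/
lemma integral_fourier_sub_mul_fourier {f g : ℝ → ℂ} (hfc : Continuous f) (hf : Integrable f)
    (hf' : Integrable (𝓕 f)) (hg : Integrable g) (x : ℝ) :
    ∫ v, 𝓕 f (x - v) * 𝓕 g v = 𝓕 (fun t => f t * g t) x := by
  have hflip := VectorFourier.integral_fourierIntegral_smul_eq_flip (L := innerₗ ℝ)
    Real.continuous_fourierChar continuous_inner hg (hf'.comp_sub_left x)
  rw [flip_innerₗ] at hflip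
  change ∫ v, 𝓕 g v • 𝓕 f (x - v) = ∫ t, g t • 𝓕 (fun v => 𝓕 f (x - v)) t at hflip
  have hshift (t : ℝ) : 𝓕 (fun v => 𝓕 f (x - v)) t =
      cexp (↑(-2 * Real.pi * t * x) * I) * f t := by
    rw [← congr_fun (hfc.fourierInv_fourier_eq hf hf') t, Real.fourier_real_eq_integral_exp_smul,
      Real.fourierInv_eq', ← integral_const_mul, ← integral_sub_left_eq_self _ volume x]
    congr 1 with v
    rw [sub_sub_cancel, smul_eq_mul, smul_eq_mul, ← mul_assoc, ← Complex.exp_add]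
    congr 2
    simp only [RCLike.inner_apply, conj_trivial]
    push_cast
    ring
  simp only [smul_eq_mul, hshift] at hflip
  simp_rw [mul_comm (𝓕 f _), hflip]
  rw [Real.fourier_real_eq_integral_exp_smul]
  congr 1 with t
  simp only [smul_eq_mul]
  ring

lemma airyIntegrand_mul (α β x : ℝ) (w : ℂ) :
    airyIntegrand α 0 w * airyIntegrand β x w = airyIntegrand (α + β) x w := by
  simp only [airyIntegrand, ← Complex.exp_add]
  congr 1
  push_cast
  ring

lemma exp_mul_scaledAi {α : ℝ} (hα : 0 < α) (x : ℝ) :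
    ((Real.exp x * scaledAi α x : ℝ) : ℂ) = (2 * Real.pi : ℂ)⁻¹ *
      𝓕 (fun t : ℝ => airyIntegrand α 0 (1 + t * I)) ((2 * Real.pi)⁻¹ * x) := by
  have hpi : 2 * Real.pi * ((2 * Real.pi)⁻¹ * x) = x :=
    mul_inv_cancel_left₀ Real.two_pi_pos.ne' x
  rw [fourier_airyIntegrand, hpi, ofReal_mul, ofReal_scaledAi hα]
  ring

/-- The dilated Airy functions form a convolution semigroup. -/
lemma integral_scaledAi_mul_scaledAi {α β : ℝ} (hα : 0 < α) (hβ : 0 < β) (x y : ℝ) :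
    ∫ z, scaledAi α (x - z) * scaledAi β (z - y) = scaledAi (α + β) (x - y) := by
  set g : ℝ → ℝ → ℂ := fun γ t => airyIntegrand γ 0 (1 + t * I)
  have hg {γ : ℝ} (hγ : 0 < γ) : Integrable (g γ) := by
    simpa using integrable_airyIntegrand hγ one_pos 0
  have hcont : Continuous (g α) := (continuous_airyIntegrand α 0).comp (by fun_prop)
  have hconv := integral_fourier_sub_mul_fourier hcont (hg hα)
    (integrable_fourier_airyIntegrand hα) (hg hβ) ((2 * Real.pi)⁻¹ * (x - y))
  simp only [g, airyIntegrand_mul] at hconv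
  have hscale := Measure.integral_comp_mul_left
    (fun v => 𝓕 (g α) ((2 * Real.pi)⁻¹ * (x - y) - v) * 𝓕 (g β) v) (2 * Real.pi)⁻¹
  have htwopi : (2 * Real.pi : ℂ) ≠ 0 := by exact_mod_cast Real.two_pi_pos.ne'
  rw [inv_inv, abs_of_pos Real.two_pi_pos, hconv, real_smul] at hscale
  have key : ∫ z, (Real.exp (x - z) * scaledAi α (x - z)) *
      (Real.exp (z - y) * scaledAi β (z - y)) =
      Real.exp (x - y) * scaledAi (α + β) (x - y) := by
    apply ofReal_injective
    rw [exp_mul_scaledAi (add_pos hα hβ), ← integral_complex_ofReal,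
      ← integral_add_right_eq_self _ y]
    simp only [add_sub_cancel_right]
    simp_rw [ofReal_mul _ (Real.exp _ * _), exp_mul_scaledAi hα, exp_mul_scaledAi hβ]
    calc _ = ((2 * Real.pi : ℂ)⁻¹ * (2 * Real.pi : ℂ)⁻¹) * ∫ z,
          𝓕 (g α) ((2 * Real.pi)⁻¹ * (x - y) - (2 * Real.pi)⁻¹ * z) *
            𝓕 (g β) ((2 * Real.pi)⁻¹ * z) := by
          rw [← integral_const_mul]
          congr 1 with z
          rw [← mul_sub, sub_add_eq_sub_sub_swap]
          ring
      _ = _ := by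
          rw [hscale, ofReal_mul, ofReal_ofNat, mul_assoc, inv_mul_cancel_left₀ htwopi]
  have hexp (z : ℝ) : (Real.exp (x - z) * scaledAi α (x - z)) *
      (Real.exp (z - y) * scaledAi β (z - y)) =
      Real.exp (x - y) * (scaledAi α (x - z) * scaledAi β (z - y)) := by
    rw [mul_mul_mul_comm, ← Real.exp_add, sub_add_sub_cancel]
  simp_rw [hexp, integral_const_mul] at key
  exact mul_left_cancel₀ (Real.exp_pos _).ne' key

/-- The product of the values of `f` at the successive differences of the chain
`x, z₁, …, zₘ, y`. -/
noncomputable def chainProd (f : ℝ → ℝ) (m : ℕ) (x y : ℝ) (z : Fin m → ℝ) : ℝ :=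
  ∏ i : Fin (m + 1), f ((Fin.cons x (Fin.snoc z y) : Fin (m + 2) → ℝ) i.castSucc
    - (Fin.cons x (Fin.snoc z y) : Fin (m + 2) → ℝ) i.succ)

lemma chainProd_zero (f : ℝ → ℝ) (x y : ℝ) (z : Fin 0 → ℝ) : chainProd f 0 x y z = f (x - y) := by
  simp [chainProd, Fin.snoc]

lemma chainProd_succ (f : ℝ → ℝ) (m : ℕ) (x y u : ℝ) (z : Fin m → ℝ) :
    chainProd f (m + 1) x y (Fin.cons u z) = f (x - u) * chainProd f m u y z := by
  rw [chainProd, ← Fin.cons_snoc_eq_snoc_cons, Fin.prod_univ_succ]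
  simp only [Fin.castSucc_zero, Fin.cons_zero, Fin.cons_succ, ← Fin.succ_castSucc]
  rfl

lemma chainProd_exp_mul (f : ℝ → ℝ) (m : ℕ) (x y : ℝ) (z : Fin m → ℝ) :
    chainProd (fun a => Real.exp a * f a) m x y z = Real.exp (x - y) * chainProd f m x y z := by
  induction m generalizing x with
  | zero => simp only [chainProd_zero]
  | succ m ih =>
    rw [← Fin.cons_self_tail z, chainProd_succ, chainProd_succ, ih, ← sub_add_sub_cancel x (z 0) y,
      Real.exp_add]
    ring

lemma Continuous.chainProd {f : ℝ → ℝ} (hf : Continuous f) (m : ℕ) (y : ℝ) :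
    Continuous fun p : ℝ × (Fin m → ℝ) => chainProd f m p.1 y p.2 := by
  unfold _root_.chainProd
  refine continuous_finsetProd _ fun i _ => hf.comp ?_
  fun_prop

/-- Splitting off the first coordinate of a point of `ℝ^(m+1)` preserves the volume. -/
lemma measurePreserving_finCons (m : ℕ) :
    MeasurePreserving (MeasurableEquiv.piFinSuccAbove (fun _ : Fin (m + 1) => ℝ) 0).symm :=
  (volume_preserving_piFinSuccAbove (fun _ : Fin (m + 1) => ℝ) 0).symm _

lemma chainProd_piFinSuccAbove_symm (f : ℝ → ℝ) (m : ℕ) (x y : ℝ) (p : ℝ × (Fin m → ℝ)) :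
    chainProd f (m + 1) x y ((MeasurableEquiv.piFinSuccAbove (fun _ => ℝ) 0).symm p) =
      f (x - p.1) * chainProd f m p.1 y p.2 := by
  rw [← chainProd_succ]
  simp [MeasurableEquiv.piFinSuccAbove_symm_apply, Fin.consEquiv]

lemma integrable_chainProd_and_integral_norm_le {f : ℝ → ℝ} (hc : Continuous f)
    (hf : Integrable f) {K : ℝ} (hK : ∀ a, ‖f a‖ ≤ K) (m : ℕ) (x y : ℝ) :
    Integrable (chainProd f m x y) ∧
      ∫ z, ‖chainProd f m x y z‖ ≤ K * (∫ a, ‖f a‖) ^ m := by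
  induction m generalizing x with
  | zero =>
    have h : chainProd f 0 x y = fun _ => f (x - y) := funext (chainProd_zero f x y)
    have hvol : (volume : Measure (Fin 0 → ℝ)) = Measure.dirac isEmptyElim :=
      Measure.volume_pi_eq_dirac _
    rw [h, hvol]
    exact ⟨integrable_const _, by simpa using hK (x - y)⟩
  | succ m ih =>
    set e := MeasurableEquiv.piFinSuccAbove (fun _ : Fin (m + 1) => ℝ) 0
    have he : MeasurePreserving e.symm := measurePreserving_finCons m
    have hsplit (p : ℝ × (Fin m → ℝ)) :
        chainProd f (m + 1) x y (e.symm p) = f (x - p.1) * chainProd f m p.1 y p.2 :=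
      chainProd_piFinSuccAbove_symm f m x y p
    have hmeas : AEStronglyMeasurable
        (fun p : ℝ × (Fin m → ℝ) => f (x - p.1) * chainProd f m p.1 y p.2)
        (volume.prod volume) :=
      ((hc.comp (continuous_const.sub continuous_fst)).mul (hc.chainProd m y)).aestronglyMeasurable
    have hle (u : ℝ) : ∫ z, ‖f (x - u) * chainProd f m u y z‖ ≤
        ‖f (x - u)‖ * (K * (∫ a, ‖f a‖) ^ m) := by
      simp_rw [norm_mul, integral_const_mul]
      exact mul_le_mul_of_nonneg_left (ih u).2 (norm_nonneg _)
    have hbound : Integrable fun u => ‖f (x - u)‖ * (K * (∫ a, ‖f a‖) ^ m) :=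
      (hf.comp_sub_left x).norm.mul_const _
    have hint : Integrable (fun p : ℝ × (Fin m → ℝ) => f (x - p.1) * chainProd f m p.1 y p.2)
        (volume.prod volume) := by
      refine (integrable_prod_iff hmeas).2 ⟨.of_forall fun u => (ih u).1.const_mul (f (x - u)), ?_⟩
      refine hbound.mono' hmeas.norm.integral_prod_right' (.of_forall fun u => ?_)
      rw [Real.norm_of_nonneg (integral_nonneg fun _ => norm_nonneg _)]
      exact hle u
    constructor
    · rw [← he.integrable_comp_emb e.symm.measurableEmbedding]
      exact hint.congr (.of_forall fun p => (hsplit p).symm)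
    · rw [← he.integral_comp e.symm.measurableEmbedding]
      simp_rw [hsplit]
      rw [Measure.volume_eq_prod, integral_prod _ hint.norm]
      refine (integral_mono hint.integral_norm_prod_left hbound hle).trans_eq ?_
      rw [integral_mul_const, integral_sub_left_eq_self (fun a => ‖f a‖) volume x, pow_succ]
      ring

lemma integral_chainProd_succ {f : ℝ → ℝ} {m : ℕ} {x y : ℝ}
    (h : Integrable (chainProd f (m + 1) x y)) :
    ∫ z, chainProd f (m + 1) x y z = ∫ u, f (x - u) * ∫ z, chainProd f m u y z := by
  set e := MeasurableEquiv.piFinSuccAbove (fun _ : Fin (m + 1) => ℝ) 0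
  have he : MeasurePreserving e.symm := measurePreserving_finCons m
  have hsplit (p : ℝ × (Fin m → ℝ)) :
      chainProd f (m + 1) x y (e.symm p) = f (x - p.1) * chainProd f m p.1 y p.2 :=
    chainProd_piFinSuccAbove_symm f m x y p
  rw [← he.integrable_comp_emb e.symm.measurableEmbedding] at h
  have hint : Integrable (fun p : ℝ × (Fin m → ℝ) => f (x - p.1) * chainProd f m p.1 y p.2)
      (volume.prod volume) := h.congr (.of_forall hsplit)
  rw [← he.integral_comp e.symm.measurableEmbedding]
  simp_rw [hsplit]
  rw [Measure.volume_eq_prod, integral_prod _ hint]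
  simp_rw [integral_const_mul]

lemma exp_mul_Ai (a : ℝ) :
    Real.exp a * Ai a =
      ((2 * Real.pi : ℂ)⁻¹ * ((Real.exp a : ℂ) * airyContour 1 1 a)).re := by
  rw [mul_left_comm, ← ofReal_Ai, ← ofReal_mul, ofReal_re]

lemma continuous_exp_mul_Ai : Continuous fun a => Real.exp a * Ai a := by
  simp_rw [exp_mul_Ai]
  exact continuous_re.comp ((continuous_exp_mul_airyContour one_pos).const_mul _)

lemma integrable_exp_mul_Ai : Integrable fun a => Real.exp a * Ai a := by
  simp_rw [exp_mul_Ai]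
  exact ((integrable_exp_mul_airyContour one_pos).const_mul _).re

lemma exists_norm_exp_mul_Ai_le : ∃ K, ∀ a, ‖Real.exp a * Ai a‖ ≤ K := by
  obtain ⟨C, hC⟩ := exists_norm_exp_mul_airyContour_le one_pos one_pos
  refine ⟨‖(2 * Real.pi : ℂ)⁻¹‖ * C, fun a => ?_⟩
  rw [exp_mul_Ai]
  refine (abs_re_le_norm _).trans ?_
  rw [norm_mul]
  gcongr
  simpa using hC a

lemma integrable_chainProd_Ai (m : ℕ) (d x y : ℝ) :
    Integrable (chainProd (fun a => Ai (a + d)) m x y) := by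
  have hexp (a : ℝ) : Real.exp a * Ai (a + d) =
      Real.exp (-d) * (Real.exp (a + d) * Ai (a + d)) := by
    rw [← mul_assoc, ← Real.exp_add, neg_add_cancel_comm_assoc]
  obtain ⟨K, hK⟩ := exists_norm_exp_mul_Ai_le
  have h := (integrable_chainProd_and_integral_norm_le (f := fun a => Real.exp a * Ai (a + d))
    (K := Real.exp (-d) * K) ?_ ?_ ?_ m x y).1
  · refine (h.const_mul (Real.exp (x - y))⁻¹).congr (.of_forall fun z => ?_)
    simp only [chainProd_exp_mul]
    exact inv_mul_cancel_left₀ (Real.exp_pos _).ne' _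
  · simp_rw [hexp]
    exact (continuous_exp_mul_Ai.comp (continuous_add_const d)).const_mul _
  · simp_rw [hexp]
    exact (integrable_exp_mul_Ai.comp_add_right d).const_mul _
  · intro a
    rw [hexp, norm_mul, Real.norm_eq_abs, Real.abs_exp]
    gcongr
    exact hK _

lemma integral_chainProd_Ai (m : ℕ) (d x y : ℝ) :
    ∫ z, chainProd (fun a => Ai (a + d)) m x y z = scaledAi (m + 1) (x - y + (m + 1) * d) := by
  induction m generalizing x with
  | zero =>
    have hvol : (volume : Measure (Fin 0 → ℝ)) = Measure.dirac isEmptyElim :=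
      Measure.volume_pi_eq_dirac _
    simp [hvol, chainProd_zero, scaledAi_one]
  | succ m ih =>
    have hm : (0 : ℝ) < m + 1 := by positivity
    have h := integral_scaledAi_mul_scaledAi one_pos hm (x + d) (y - (m + 1) * d)
    rw [integral_chainProd_succ (integrable_chainProd_Ai (m + 1) d x y)]
    simp_rw [ih]
    convert h using 2
    · ext u
      rw [scaledAi_one]
      congr 2 <;> ring
    · push_cast; ring
    · push_cast; ring

/-- For `n = m + 1 ≥ 1`: the `(n-1)`-fold convolution identity
`∫_{ℝ^{n-1}} Ai(x - z₁ + 2c)···Ai(z_{n-1} - y + 2c) dz = n^{-1/3} Ai(n^{-1/3}(x - y + 2nc))`,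
the integral being absolutely convergent.  Here the chain `x, z₁, …, z_{n-1}, y` is encoded
as `Fin.cons x (Fin.snoc z y)`. -/
theorem airy_convolution_hat (m : ℕ) (c x y : ℝ) :
    Integrable (fun z : Fin m → ℝ =>
      ∏ i : Fin (m + 1),
        Ai ((Fin.cons x (Fin.snoc z y) : Fin (m + 2) → ℝ) i.castSucc
          - (Fin.cons x (Fin.snoc z y) : Fin (m + 2) → ℝ) i.succ + 2 * c)) ∧
    (∫ z : Fin m → ℝ,
        ∏ i : Fin (m + 1),
          Ai ((Fin.cons x (Fin.snoc z y) : Fin (m + 2) → ℝ) i.castSucc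
            - (Fin.cons x (Fin.snoc z y) : Fin (m + 2) → ℝ) i.succ + 2 * c))
      = ((m : ℝ) + 1) ^ (-(1 : ℝ) / 3) *
          Ai (((m : ℝ) + 1) ^ (-(1 : ℝ) / 3) * (x - y + 2 * ((m : ℝ) + 1) * c)) := by
  have hscaled := integral_chainProd_Ai m (2 * c) x y
  rw [show x - y + ((m : ℝ) + 1) * (2 * c) = x - y + 2 * ((m : ℝ) + 1) * c by ring] at hscaled
  exact ⟨integrable_chainProd_Ai m (2 * c) x y, hscaled⟩
end

section
/- For every L > 0 and every a ∈ ℝ, the Gaussian smoothing of the Airy function satisfies (4πL)^{−1/2}·∫_ℝ exp(−(a − u)²/(4L))·Ai(u) du = exp(2L³/3 + L·a)·Ai(L² + a), the integral being absolutely convergent. -/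
open MeasureTheory

open Filter Topology

/-- The integrand of the contour integral defining the Airy function. -/
noncomputable def airyKernel (x : ℝ) (z : ℂ) : ℂ :=
  Complex.exp (z ^ 3 / 3 - z * (x : ℂ))

lemma differentiable_airyKernel (x : ℝ) : Differentiable ℂ (airyKernel x) := by
  unfold airyKernel
  fun_prop

lemma norm_airyKernel (x c t : ℝ) :
    ‖airyKernel x (c + t * Complex.I)‖ = Real.exp (c ^ 3 / 3 - c * t ^ 2 - c * x) := by
  have h : ((c : ℂ) + t * Complex.I) ^ 3 / 3 - (c + t * Complex.I) * (x : ℂ)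
      = ((c ^ 3 / 3 - c * t ^ 2 - c * x : ℝ) : ℂ)
        + ((c ^ 2 * t - t ^ 3 / 3 - t * x : ℝ) : ℂ) * Complex.I := by
    push_cast
    linear_combination ((c : ℂ) * t ^ 2 + t ^ 3 * Complex.I / 3) * Complex.I_sq
  rw [airyKernel, Complex.norm_exp, h, Complex.add_re, Complex.re_ofReal_mul]
  simp only [Complex.ofReal_re, Complex.I_re, mul_zero, add_zero]

lemma integrable_airyKernel (x : ℝ) {c : ℝ} (hc : 0 < c) :
    Integrable fun t : ℝ => airyKernel x (c + t * Complex.I) := by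
  refine ((integrable_exp_neg_mul_sq hc).const_mul (Real.exp (c ^ 3 / 3 - c * x))).mono' ?_ ?_
  · have := (differentiable_airyKernel x).continuous
    exact Continuous.aestronglyMeasurable (by fun_prop)
  · refine Eventually.of_forall fun t => le_of_eq ?_
    rw [norm_airyKernel, ← Real.exp_add]
    ring_nf

lemma norm_integral_airyKernel_horizontal_le (x : ℝ) {b c : ℝ} (hb : 0 < b) (hbc : b ≤ c)
    (T : ℝ) :
    ‖∫ s in b..c, airyKernel x (s + T * Complex.I)‖
      ≤ Real.exp (c ^ 3 / 3 + c * |x| - b * T ^ 2) * |c - b| := by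
  refine intervalIntegral.norm_integral_le_of_norm_le_const fun s hs => ?_
  rw [Set.uIoc_of_le hbc] at hs
  have hs0 : 0 ≤ s := hb.le.trans hs.1.le
  rw [norm_airyKernel, Real.exp_le_exp]
  have h3 : s ^ 3 ≤ c ^ 3 := pow_le_pow_left₀ hs0 hs.2 3
  have hT : b * T ^ 2 ≤ s * T ^ 2 := mul_le_mul_of_nonneg_right hs.1.le (sq_nonneg T)
  have hx : s * -x ≤ c * |x| :=
    (mul_le_mul_of_nonneg_left (neg_le_abs x) hs0).trans
      (mul_le_mul_of_nonneg_right hs.2 (abs_nonneg x))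
  linarith

lemma tendsto_integral_airyKernel_horizontal (x : ℝ) {b c : ℝ} (hb : 0 < b) (hbc : b ≤ c)
    {l : Filter ℝ} {u : ℝ → ℝ} (hu : Tendsto (fun T => u T ^ 2) l atTop) :
    Tendsto (fun T => ∫ s in b..c, airyKernel x (s + u T * Complex.I)) l (𝓝 0) := by
  refine squeeze_zero_norm
    (fun T => norm_integral_airyKernel_horizontal_le x hb hbc (u T)) ?_
  rw [← zero_mul |c - b|]
  refine (Real.tendsto_exp_atBot.comp ?_).mul_const _
  simp_rw [sub_eq_add_neg]
  exact tendsto_atBot_add_const_left _ _ (tendsto_neg_atTop_atBot.comp (hu.const_mul_atTop hb))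

lemma integral_airyKernel_eq (x : ℝ) {b c : ℝ} (hb : 0 < b) (hbc : b ≤ c) :
    ∫ t : ℝ, airyKernel x (c + t * Complex.I) = ∫ t : ℝ, airyKernel x (b + t * Complex.I) := by
  have hlim {c : ℝ} (hc : 0 < c) := intervalIntegral_tendsto_integral
    (integrable_airyKernel x hc) tendsto_neg_atTop_atBot tendsto_id
  have hsq : Tendsto (fun T : ℝ => T ^ 2) atTop atTop := tendsto_pow_atTop two_ne_zero
  have hlow := tendsto_integral_airyKernel_horizontal x hb hbc (u := fun T => -T)
    (by simpa only [neg_sq] using hsq)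
  have hupp := tendsto_integral_airyKernel_horizontal x hb hbc (u := fun T => T) hsq
  have hsum := ((hlow.sub hupp).add ((hlim (hb.trans_le hbc)).const_smul Complex.I)).sub
    ((hlim hb).const_smul Complex.I)
  have hzero : ∀ T : ℝ, (∫ s in b..c, airyKernel x (s + (-T : ℝ) * Complex.I))
      - (∫ s in b..c, airyKernel x (s + T * Complex.I))
      + Complex.I • (∫ t in (-T)..T, airyKernel x (c + t * Complex.I))
      - Complex.I • (∫ t in (-T)..T, airyKernel x (b + t * Complex.I)) = 0 := fun T => by
    simpa using Complex.integral_boundary_rect_eq_zero_of_differentiableOn (airyKernel x)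
      ⟨b, -T⟩ ⟨c, T⟩ (differentiable_airyKernel x).differentiableOn
  have h := tendsto_nhds_unique hsum (tendsto_const_nhds.congr fun T => (hzero T).symm)
  rw [sub_zero, zero_add, ← smul_sub] at h
  exact sub_eq_zero.mp ((smul_eq_zero.mp h).resolve_left Complex.I_ne_zero)

lemma Ai_eq_re_integral (x : ℝ) :
    Ai x = 1 / (2 * Real.pi) * (∫ t : ℝ, airyKernel x (1 + t * Complex.I)).re := by
  have h := integrable_airyKernel x one_pos
  rw [Complex.ofReal_one] at h
  exact congrArg _ (integral_re h)

lemma gaussian_mul_airyKernel_eq {L : ℝ} (hL : 0 < L) (a u : ℝ) (w : ℂ) :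
    (Real.exp (-(a - u) ^ 2 / (4 * L)) : ℂ) * airyKernel u w
      = Complex.exp (-(1 / (4 * L)) * u ^ 2 + (a / (2 * L) - w) * u
          + (w ^ 3 / 3 - a ^ 2 / (4 * L))) := by
  have hL' : (L : ℂ) ≠ 0 := Complex.ofReal_ne_zero.mpr hL.ne'
  rw [airyKernel, Complex.ofReal_exp, ← Complex.exp_add]
  congr 1
  push_cast
  field_simp
  ring

lemma re_neg_one_div_four_mul_neg {L : ℝ} (hL : 0 < L) : (-(1 / (4 * L)) : ℂ).re < 0 := by
  rw [show (-(1 / (4 * L)) : ℂ) = ((-(1 / (4 * L)) : ℝ) : ℂ) by push_cast; rfl,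
    Complex.ofReal_re, neg_lt_zero]
  positivity

lemma integral_gaussian_mul_airyKernel {L : ℝ} (hL : 0 < L) (a : ℝ) (w : ℂ) :
    ∫ u : ℝ, (Real.exp (-(a - u) ^ 2 / (4 * L)) : ℂ) * airyKernel u w
      = ((4 * Real.pi * L) ^ ((1 : ℝ) / 2) * Real.exp (2 * L ^ 3 / 3 + L * a) : ℝ)
        * airyKernel (L ^ 2 + a) (w + L) := by
  have hL' : (L : ℂ) ≠ 0 := Complex.ofReal_ne_zero.mpr hL.ne'
  simp_rw [gaussian_mul_airyKernel_eq hL]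
  rw [integral_cexp_quadratic (re_neg_one_div_four_mul_neg hL), Complex.ofReal_mul, mul_assoc,
    Complex.ofReal_cpow (by positivity), Complex.ofReal_exp, airyKernel, ← Complex.exp_add]
  congr 1
  · push_cast
    congr 1
    field_simp
  · congr 1
    push_cast
    field_simp
    ring

lemma integrable_gaussian_mul_airyKernel {L : ℝ} (hL : 0 < L) (a : ℝ) :
    Integrable (fun p : ℝ × ℝ => (Real.exp (-(a - p.1) ^ 2 / (4 * L)) : ℂ)
      * airyKernel p.1 (1 + p.2 * Complex.I)) (volume.prod volume) := by
  have hgauss : Integrable fun u : ℝ => (Real.exp (-(a - u) ^ 2 / (4 * L)) : ℂ)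
      * airyKernel u 1 := by
    simp_rw [gaussian_mul_airyKernel_eq hL]
    exact integrable_cexp_quadratic' (re_neg_one_div_four_mul_neg hL) _ _
  refine (hgauss.norm.mul_prod (integrable_exp_neg_mul_sq one_pos)).mono' ?_ ?_
  · unfold airyKernel
    exact Continuous.aestronglyMeasurable (by fun_prop)
  · refine Eventually.of_forall fun p => le_of_eq ?_
    have h₀ := norm_airyKernel p.1 1 0
    have h₁ := norm_airyKernel p.1 1 p.2
    rw [Complex.ofReal_one] at h₀ h₁
    rw [Complex.ofReal_zero, zero_mul, add_zero] at h₀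
    rw [norm_mul, norm_mul, h₀, h₁, mul_assoc, ← Real.exp_add]
    ring_nf

lemma gaussian_mul_Ai_eq (L a u : ℝ) :
    Real.exp (-(a - u) ^ 2 / (4 * L)) * Ai u = 1 / (2 * Real.pi) *
      (∫ t : ℝ, (Real.exp (-(a - u) ^ 2 / (4 * L)) : ℂ)
        * airyKernel u (1 + t * Complex.I)).re := by
  rw [Ai_eq_re_integral, integral_const_mul, Complex.re_ofReal_mul]
  ring

/-- Gaussian smoothing of the Airy function:
`(4πL)^{-1/2} ∫_ℝ e^{-(a-u)²/(4L)} Ai(u) du = e^{2L³/3 + La} Ai(L² + a)`. -/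
theorem heat_semigroup_airy (L a : ℝ) (hL : 0 < L) :
    Integrable (fun u : ℝ => Real.exp (-(a - u) ^ 2 / (4 * L)) * Ai u) ∧
    (4 * Real.pi * L) ^ (-(1 : ℝ) / 2) *
        (∫ u : ℝ, Real.exp (-(a - u) ^ 2 / (4 * L)) * Ai u)
      = Real.exp (2 * L ^ 3 / 3 + L * a) * Ai (L ^ 2 + a) := by
  have hint := integrable_gaussian_mul_airyKernel hL a
  have hinner := hint.integral_prod_left
  simp_rw [gaussian_mul_Ai_eq]
  refine ⟨hinner.re.const_mul _, ?_⟩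
  have hshift : ∫ t : ℝ, airyKernel (L ^ 2 + a) (1 + t * Complex.I + L)
      = ∫ t : ℝ, airyKernel (L ^ 2 + a) (1 + t * Complex.I) := by
    have h := integral_airyKernel_eq (L ^ 2 + a) one_pos (le_add_of_nonneg_right hL.le)
    push_cast at h
    simpa only [add_right_comm] using h
  have hre := integral_re hinner
  simp only [RCLike.re_eq_complex_re] at hre
  rw [integral_const_mul, hre, integral_integral_swap hint]
  simp_rw [integral_gaussian_mul_airyKernel hL]
  rw [integral_const_mul, hshift, Complex.re_ofReal_mul, Ai_eq_re_integral]
  have hpow : (4 * Real.pi * L) ^ (-(1 : ℝ) / 2) * (4 * Real.pi * L) ^ ((1 : ℝ) / 2) = 1 := by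
    rw [← Real.rpow_add (by positivity)]
    norm_num
  linear_combination (1 / (2 * Real.pi) * Real.exp (2 * L ^ 3 / 3 + L * a)
    * (∫ t : ℝ, airyKernel (L ^ 2 + a) (1 + t * Complex.I)).re) * hpow
end
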